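/- (Almost orthogonality principle.) Let U ⊆ (0,∞) and let (a_n : n ∈ ℤ) ⊆ (0,∞) satisfy 1 < a ≤ a_{n+1}/a_n ≤ a² for all n; set U_n = [a_n, a_{n+1}) ∩ U. Let (T_t : t ∈ U) be linear operators on functions ℤ^d → ℂ with T_t = M_t − H_t, where M_t and H_t are positive linear operators (Tf ≥ 0 whenever f ≥ 0). Assume: (i) for every p ∈ (1,2] the maximal operator f ↦ sup_{t∈U}|H_t f| is bounded on ℓ^p(ℤ^d); (ii) there is p₀ ∈ (1,2) such that for every p ∈ (p₀,2], sup_{n∈ℤ} ‖ f ↦ sup_{t∈U_n}|T_t f| ‖_{ℓ^p→ℓ^p} < ∞; (iii) there is a family of linear operators (S_n : n ∈ ℤ) on ℓ²(ℤ^d) with f = Σ_{n∈ℤ} S_n f in ℓ²(ℤ^d) for every f ∈ ℓ²(ℤ^d) and with ‖(Σ_{n∈ℤ}|S_n f|²)^{1/2}‖_{ℓ^p} ≤ C_p a ‖f‖_{ℓ^p} for every p ∈ (1,∞), and there is a sequence (b_j : j ∈ ℤ) of positive numbers with Σ_{j∈ℤ} b_j^ρ < ∞ for every ρ > 0 such that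 for every j ∈ ℤ and every f with ‖f‖_{ℓ²} ≤ 1 it holds ‖(Σ_{n∈ℤ} sup_{t∈U_n}|T_t S_{j+n} f|²)^{1/2}‖_{ℓ²} ≤ b_j. Then for every p ∈ (p₀, 2] there exists a constant 𝐂_p > 0 such that ‖(Σ_{n∈ℤ} sup_{t∈U_n}|T_t f|²)^{1/2}‖_{ℓ^p} ≤ 𝐂_p ‖f‖_{ℓ^p} for all f ∈ ℓ^p(ℤ^d); in particular ‖ f ↦ sup_{t∈U}|T_t f| ‖_{ℓ^p→ℓ^p} ≤ 𝐂_p. -/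

import Mathlib

open MeasureTheory ENNReal

/-- The ℓ^p(ℤ^d) "norm" of a nonnegative (ℝ≥0∞-valued) function, `p ∈ (0,∞]`. -/
noncomputable def lpZ (d : ℕ) (p : ℝ≥0∞) (g : (Fin d → ℤ) → ℝ≥0∞) : ℝ≥0∞ :=
  if p = ∞ then ⨆ x, g x else (∑' x, g x ^ p.toReal) ^ (1 / p.toReal)

/-- `x ↦ ‖f x‖₊` as an ℝ≥0∞-valued function. -/
noncomputable def nnC {d : ℕ} (f : (Fin d → ℤ) → ℂ) : (Fin d → ℤ) → ℝ≥0∞ :=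
  fun x => (‖f x‖₊ : ℝ≥0∞)

/-- A ℂ-valued function on ℤ^d is nonnegative if it is real-valued with nonnegative values. -/
def NonnegFun {d : ℕ} (f : (Fin d → ℤ) → ℂ) : Prop :=
  ∀ x, (f x).im = 0 ∧ 0 ≤ (f x).re


lemma ao_holder {ι : Type*} (f g : ι → ℝ≥0∞) {p q : ℝ} (hpq : p.HolderConjugate q) :
    ∑' i, f i * g i ≤ (∑' i, f i ^ p) ^ (1 / p) * (∑' i, g i ^ q) ^ (1 / q) := by
  let _ : MeasurableSpace ι := ⊤
  have h := ENNReal.lintegral_mul_le_Lp_mul_Lq (Measure.count : Measure ι) hpq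
    (f := f) (g := g) (measurable_from_top.aemeasurable) (measurable_from_top.aemeasurable)
  simpa [lintegral_count] using h

lemma ao_sum_rpow {ι : Type*} (f : ι → ℝ≥0∞) {r : ℝ} (h0 : 0 < r) (h1 : r ≤ 1) (s : Finset ι) :
    (∑ i ∈ s, f i) ^ r ≤ ∑ i ∈ s, f i ^ r := by
  classical
  induction s using Finset.induction_on with
  | empty => simp [h0]
  | insert a s ha ih =>
    rw [Finset.sum_insert ha, Finset.sum_insert ha]
    exact (ENNReal.rpow_add_le_add_rpow _ _ h0.le h1).trans (by gcongr)

lemma ao_tsum_rpow {ι : Type*} (f : ι → ℝ≥0∞) {r : ℝ} (h0 : 0 < r) (h1 : r ≤ 1) :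
    (∑' i, f i) ^ r ≤ ∑' i, f i ^ r := by
  refine le_of_tendsto (((ENNReal.continuous_rpow_const (y := r)).tendsto _).comp
    (ENNReal.summable (f := f)).hasSum) (Filter.Eventually.of_forall fun s => ?_)
  exact (ao_sum_rpow f h0 h1 s).trans (ENNReal.sum_le_tsum s)

lemma ao_geo (ε : ℝ) (hε : 0 < ε) : ∃ c : ℝ≥0∞, c ≠ ⊤ ∧ ∀ w : ℝ≥0∞,
    ∑' k : ℤ, (if (2 : ℝ≥0∞) ^ (k : ℝ) ≤ w then (2 : ℝ≥0∞) ^ (k * ε) else 0) ≤ c * w ^ ε := by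
  have hr : (2 : ℝ≥0∞) ^ (-ε) < 1 :=
    ENNReal.rpow_lt_one_of_one_lt_of_neg (by norm_num) (by linarith)
  have hc0 : (1 - (2 : ℝ≥0∞) ^ (-ε))⁻¹ ≠ 0 := by
    simp [ENNReal.sub_eq_top_iff]
  refine ⟨(1 - (2 : ℝ≥0∞) ^ (-ε))⁻¹, ?_, fun w => ?_⟩
  · simp [tsub_eq_zero_iff_le, hr]
  rcases eq_or_ne w 0 with rfl | hw0
  · have : ∀ k : ℤ, ¬ (2 : ℝ≥0∞) ^ (k : ℝ) ≤ 0 := fun k h =>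
      absurd (ENNReal.rpow_pos (p := (k : ℝ)) (x := 2) (by norm_num) (by norm_num)) (not_lt.mpr h)
    simp only [this, if_false, tsum_zero, zero_le]
  rcases eq_or_ne w ⊤ with rfl | hwt
  · rw [ENNReal.top_rpow_of_pos hε, ENNReal.mul_top hc0]; exact le_top
  obtain ⟨k0, hk1, hk2⟩ := ENNReal.exists_mem_Ico_zpow hw0 hwt (y := 2) (by norm_num) (by norm_num)
  rw [← ENNReal.rpow_intCast] at hk1 hk2
  have hsupp : Function.support (fun k : ℤ => if (2 : ℝ≥0∞) ^ (k : ℝ) ≤ w then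
      (2 : ℝ≥0∞) ^ (k * ε) else 0) ⊆ Set.range (fun m : ℕ => k0 - (m : ℤ)) := by
    intro k hk
    have hk' : (2 : ℝ≥0∞) ^ (k : ℝ) ≤ w := by
      by_contra h
      exact hk (if_neg h)
    have : (2 : ℝ≥0∞) ^ (k : ℝ) < 2 ^ ((k0 + 1 : ℤ) : ℝ) := lt_of_le_of_lt hk' hk2
    have h3 : k < k0 + 1 := by
      by_contra hcon
      push Not at hcon
      have : (2 : ℝ≥0∞) ^ ((k0 + 1 : ℤ) : ℝ) ≤ 2 ^ (k : ℝ) :=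
        ENNReal.rpow_le_rpow_of_exponent_le (by norm_num) (by exact_mod_cast hcon)
      exact absurd this (not_le.mpr ‹_›)
    exact ⟨(k0 - k).toNat, by simp; omega⟩
  have hinj : Function.Injective (fun m : ℕ => k0 - (m : ℤ)) := by
    intro m n h; simpa using h
  rw [← hinj.tsum_eq hsupp]
  calc ∑' m : ℕ, (if (2 : ℝ≥0∞) ^ ((k0 - (m : ℤ) : ℤ) : ℝ) ≤ w then
        (2 : ℝ≥0∞) ^ (((k0 - (m : ℤ) : ℤ) : ℝ) * ε) else 0)
      ≤ ∑' m : ℕ, (2 : ℝ≥0∞) ^ (k0 * ε) * ((2 : ℝ≥0∞) ^ (-ε)) ^ m := by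
        refine ENNReal.tsum_le_tsum fun m => ?_
        have : (2 : ℝ≥0∞) ^ (((k0 - (m : ℤ) : ℤ) : ℝ) * ε)
            = (2 : ℝ≥0∞) ^ (k0 * ε) * ((2 : ℝ≥0∞) ^ (-ε)) ^ m := by
          rw [← ENNReal.rpow_mul_natCast, ← ENNReal.rpow_add _ _ (by norm_num) (by norm_num)]
          congr 1; push_cast; ring
        rw [← this]
        split_ifs <;> simp
    _ = (1 - (2 : ℝ≥0∞) ^ (-ε))⁻¹ * ((2 : ℝ≥0∞) ^ (k0 : ℝ)) ^ ε := by
        rw [ENNReal.tsum_mul_left, ENNReal.tsum_geometric, mul_comm, ENNReal.rpow_mul]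
    _ ≤ _ := by gcongr

lemma ao_pos_norm {X : Type*} (φ : (X → ℂ) →ₗ[ℂ] ℂ)
    (hφ : ∀ f : X → ℂ, (∀ x, (f x).im = 0 ∧ 0 ≤ (f x).re) → (φ f).im = 0 ∧ 0 ≤ (φ f).re)
    (f : X → ℂ) (u : X → ℝ) (hu : ∀ x, ‖f x‖ ≤ u x) :
    ‖φ f‖ ≤ (φ (fun x => (u x : ℂ))).re := by
  -- real functions have real image
  have hreal : ∀ v : X → ℝ, (φ (fun x => (v x : ℂ))).im = 0 := by
    intro v
    have h : (fun x => (v x : ℂ)) = (fun x => ((max (v x) 0 : ℝ) : ℂ))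
        - (fun x => ((max (-v x) 0 : ℝ) : ℂ)) := by
      funext x
      simp only [Pi.sub_apply, ← Complex.ofReal_sub]
      congr 1
      rcases le_total (v x) 0 with h | h
      · rw [max_eq_right h, max_eq_left (by linarith)]; ring
      · rw [max_eq_left h, max_eq_right (by linarith)]; ring
    rw [h, map_sub, Complex.sub_im, (hφ _ fun x => ⟨by simp, by simp⟩).1,
      (hφ _ fun x => ⟨by simp, by simp⟩).1, sub_zero]
  have hmono : ∀ v w : X → ℝ, (∀ x, v x ≤ w x) →
      (φ (fun x => (v x : ℂ))).re ≤ (φ (fun x => (w x : ℂ))).re := by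
    intro v w hvw
    have h : (fun x => ((w x - v x : ℝ) : ℂ)) = (fun x => (w x : ℂ)) - (fun x => (v x : ℂ)) := by
      funext x; simp
    have := (hφ (fun x => ((w x - v x : ℝ) : ℂ)) fun x => ⟨by simp, by simp [hvw x]⟩).2
    rw [h, map_sub, Complex.sub_re] at this
    linarith
  obtain ⟨c, hc1, hc2⟩ : ∃ c : ℂ, ‖c‖ = 1 ∧ c * φ f = (‖φ f‖ : ℂ) := by
    rcases eq_or_ne (φ f) 0 with h | h
    · exact ⟨1, by simp, by simp [h]⟩
    · have hn : (‖φ f‖ : ℂ) ≠ 0 := by simpa using h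
      refine ⟨‖φ f‖ / φ f, by simp [h], by field_simp⟩
  have hdec : c • f = (fun x => ((c * f x).re : ℂ)) + Complex.I • (fun x => ((c * f x).im : ℂ)) := by
    funext x
    simp only [Pi.smul_apply, smul_eq_mul, Pi.add_apply]
    rw [mul_comm Complex.I]
    exact (Complex.re_add_im _).symm
  have h1 : (‖φ f‖ : ℂ) = φ (fun x => ((c * f x).re : ℂ))
      + Complex.I * φ (fun x => ((c * f x).im : ℂ)) := by
    rw [← hc2, ← smul_eq_mul, ← map_smul, hdec, map_add, map_smul, smul_eq_mul]
  have h2 : ‖φ f‖ = (φ (fun x => ((c * f x).re : ℂ))).re := by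
    have := congrArg Complex.re h1
    rw [Complex.ofReal_re, Complex.add_re, Complex.mul_re, hreal (fun x => (c * f x).im),
      Complex.I_re, zero_mul, mul_zero, sub_zero, add_zero] at this
    exact this
  rw [h2]
  refine hmono _ _ fun x => ?_
  calc (c * f x).re ≤ ‖c * f x‖ := Complex.re_le_norm _
    _ ≤ u x := by rw [norm_mul, hc1, one_mul]; exact hu x

lemma ao_pos_holder {X : Type*} (φ : (X → ℂ) →ₗ[ℂ] ℂ)
    (hφ : ∀ f : X → ℂ, (∀ x, (f x).im = 0 ∧ 0 ≤ (f x).re) → (φ f).im = 0 ∧ 0 ≤ (φ f).re)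
    (w u v : X → ℝ) (hu0 : ∀ x, 0 ≤ u x) (hv0 : ∀ x, 0 ≤ v x) (θ : ℝ) (h0 : 0 < θ) (h1 : θ < 1)
    (hw0 : ∀ x, 0 ≤ w x)
    (hw : ∀ x, w x ≤ u x ^ (1 - θ) * v x ^ θ) :
    (φ (fun x => (w x : ℂ))).re ≤ ‖φ (fun x => (u x : ℂ))‖ ^ (1 - θ) *
      ‖φ (fun x => (v x : ℂ))‖ ^ θ := by
  set a := ‖φ (fun x => (u x : ℂ))‖ with ha
  set b := ‖φ (fun x => (v x : ℂ))‖ with hb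
  have ha0 : 0 ≤ a := norm_nonneg _
  have hb0 : 0 ≤ b := norm_nonneg _
  have key : ∀ ε : ℝ, 0 < ε → (φ (fun x => (w x : ℂ))).re ≤ (a + ε) ^ (1 - θ) * (b + ε) ^ θ := by
    intro ε hε
    set P := (a + ε) ^ (1 - θ) * (b + ε) ^ θ with hP
    have hP0 : 0 < P := by positivity
    set c1 : ℝ := P * ((1 - θ) / (a + ε))
    set c2 : ℝ := P * (θ / (b + ε))
    have hpt : ∀ x, ‖(w x : ℂ)‖ ≤ c1 * u x + c2 * v x := by
      intro x
      rw [Complex.norm_real, Real.norm_of_nonneg (hw0 x)]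
      refine (hw x).trans ?_
      have := Real.geom_mean_le_arith_mean2_weighted (w₁ := 1 - θ) (w₂ := θ) (p₁ := u x / (a + ε))
        (p₂ := v x / (b + ε)) (by linarith) h0.le (div_nonneg (hu0 x) (by positivity))
        (div_nonneg (hv0 x) (by positivity)) (by ring)
      rw [Real.div_rpow (hu0 x) (by positivity), Real.div_rpow (hv0 x) (by positivity)] at this
      have h2 := mul_le_mul_of_nonneg_left this hP0.le
      have h3 : P * (u x ^ (1 - θ) / (a + ε) ^ (1 - θ) * (v x ^ θ / (b + ε) ^ θ))
          = u x ^ (1 - θ) * v x ^ θ := by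
        rw [hP]; field_simp
      rw [h3] at h2
      refine h2.trans (le_of_eq ?_)
      simp only [c1, c2]; ring
    have h4 := ao_pos_norm φ hφ (fun x => (w x : ℂ)) _ hpt
    have h5 : (fun x => ((c1 * u x + c2 * v x : ℝ) : ℂ))
        = (c1 : ℂ) • (fun x => (u x : ℂ)) + (c2 : ℂ) • (fun x => (v x : ℂ)) := by
      funext x; simp
    rw [h5, map_add, map_smul, map_smul] at h4
    simp only [smul_eq_mul, Complex.add_re, Complex.re_ofReal_mul] at h4
    refine (Complex.re_le_norm _).trans (h4.trans ?_)
    have h6 : (φ (fun x => (u x : ℂ))).re ≤ a + ε := (Complex.re_le_norm _).trans (by linarith)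
    have h7 : (φ (fun x => (v x : ℂ))).re ≤ b + ε := (Complex.re_le_norm _).trans (by linarith)
    have hc1 : 0 ≤ c1 := mul_nonneg hP0.le (div_nonneg (by linarith) (by positivity))
    have hc2 : 0 ≤ c2 := mul_nonneg hP0.le (div_nonneg (by linarith) (by positivity))
    calc _ ≤ c1 * (a + ε) + c2 * (b + ε) := by gcongr
      _ = P := by
        have : a + ε ≠ 0 := by positivity
        have : b + ε ≠ 0 := by positivity
        simp only [c1, c2]; field_simp; ring
  have hlim : Filter.Tendsto (fun ε : ℝ => (a + ε) ^ (1 - θ) * (b + ε) ^ θ)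
      (nhdsWithin 0 (Set.Ioi 0)) (nhds (a ^ (1 - θ) * b ^ θ)) := by
    have hc : Continuous (fun ε : ℝ => (a + ε) ^ (1 - θ) * (b + ε) ^ θ) := by
      refine Continuous.mul ?_ ?_
      · exact (continuous_const.add continuous_id).rpow_const fun _ => Or.inr (by linarith)
      · exact (continuous_const.add continuous_id).rpow_const fun _ => Or.inr h0.le
    have := hc.tendsto 0
    simp only [add_zero] at this
    exact this.mono_left nhdsWithin_le_nhds
  exact ge_of_tendsto hlim (eventually_nhdsWithin_of_forall fun ε hε => key ε hε)

lemma ao_marc_pt {p q : ℝ} (hqp : q < p) (hq : 0 < q) (hp : p < 2) (y : ℝ≥0∞) (hy : y ≠ ⊤)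
    (a b : ℤ → ℝ≥0∞) (hab : ∀ k, y ≤ 2 * (a k + b k)) :
    y ^ p ≤ (4 ^ q * 2 ^ (p - q)) * ∑' k : ℤ, (2 : ℝ≥0∞) ^ (k * (p - q)) * a k ^ q
      + 16 * ∑' k : ℤ, (2 : ℝ≥0∞) ^ (-k * (2 - p)) * b k ^ (2 : ℝ) := by
  rcases eq_or_ne y 0 with rfl | hy0
  · rw [ENNReal.zero_rpow_of_pos (by linarith)]; exact zero_le
  obtain ⟨k, hk1, hk2⟩ := ENNReal.exists_mem_Ioc_zpow hy0 hy (y := 2) (by norm_num) (by norm_num)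
  rw [← ENNReal.rpow_intCast] at hk1 hk2
  rcases le_total (a k) (b k) with h | h
  · refine le_trans ?_ le_add_self
    have hyb : y ≤ 4 * b k := (hab k).trans (by
      calc 2 * (a k + b k) ≤ 2 * (b k + b k) := by gcongr
        _ = 4 * b k := by ring)
    calc y ^ p = y ^ (2 : ℝ) * y ^ (p - 2) := by
          rw [← ENNReal.rpow_add _ _ hy0 hy]; congr 1; ring
      _ ≤ (4 * b k) ^ (2 : ℝ) * (2 ^ (k : ℝ)) ^ (p - 2) := by
          refine mul_le_mul' (ENNReal.rpow_le_rpow hyb (by norm_num)) ?_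
          have : p - 2 = -(2 - p) := by ring
          rw [this, ENNReal.rpow_neg, ENNReal.rpow_neg, ENNReal.inv_le_inv]
          exact ENNReal.rpow_le_rpow hk1.le (by linarith)
      _ = 16 * ((2 : ℝ≥0∞) ^ (-k * (2 - p)) * b k ^ (2 : ℝ)) := by
          rw [ENNReal.mul_rpow_of_nonneg _ _ (by norm_num : (0:ℝ) ≤ 2), ← ENNReal.rpow_mul]
          have : (4 : ℝ≥0∞) ^ (2 : ℝ) = 16 := by
            rw [ENNReal.rpow_two]; norm_num
          rw [this]
          have : (k : ℝ) * (p - 2) = -k * (2 - p) := by ring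
          rw [this]; ring
      _ ≤ _ := by
          gcongr
          exact ENNReal.le_tsum k
  · refine le_trans ?_ le_self_add
    have hyb : y ≤ 4 * a k := (hab k).trans (by
      calc 2 * (a k + b k) ≤ 2 * (a k + a k) := by gcongr
        _ = 4 * a k := by ring)
    calc y ^ p = y ^ q * y ^ (p - q) := by
          rw [← ENNReal.rpow_add _ _ hy0 hy]; congr 1; ring
      _ ≤ (4 * a k) ^ q * (2 ^ ((k + 1 : ℤ) : ℝ)) ^ (p - q) := by
          exact mul_le_mul' (ENNReal.rpow_le_rpow hyb hq.le)
            (ENNReal.rpow_le_rpow hk2 (by linarith))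
      _ = (4 ^ q * 2 ^ (p - q)) * ((2 : ℝ≥0∞) ^ (k * (p - q)) * a k ^ q) := by
          rw [ENNReal.mul_rpow_of_nonneg _ _ hq.le, ← ENNReal.rpow_mul]
          have : ((k + 1 : ℤ) : ℝ) * (p - q) = (p - q) + k * (p - q) := by push_cast; ring
          rw [this, ENNReal.rpow_add _ _ (by norm_num) (by norm_num)]
          ring
      _ ≤ _ := by
          gcongr
          exact ENNReal.le_tsum k

lemma ao_marc {X : Type*} {p q : ℝ} (hqp : q < p) (hq : 0 < q) (hp : p < 2) :
    ∃ C : ℝ≥0∞, C ≠ ⊤ ∧ ∀ (Q : (X → ℂ) → X → ℝ≥0∞) (K1 K2 γ : ℝ≥0∞), γ ≠ 0 → γ ≠ ⊤ →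
      (∀ f g x, Q (f + g) x ≤ 2 * (Q f x + Q g x)) →
      (∀ f, ∑' x, Q f x ^ q ≤ K1 * ∑' x, (‖f x‖₊ : ℝ≥0∞) ^ q) →
      (∀ f, ∑' x, Q f x ^ (2 : ℝ) ≤ K2 * ∑' x, (‖f x‖₊ : ℝ≥0∞) ^ (2 : ℝ)) →
      ∀ f, (∀ x, Q f x ≠ ⊤) → ∑' x, Q f x ^ p ≤
        C * (K1 * γ ^ (q - p) + K2 * γ ^ (2 - p)) * ∑' x, (‖f x‖₊ : ℝ≥0∞) ^ p := by
  obtain ⟨c1, hc1, hg1⟩ := ao_geo (p - q) (by linarith)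
  obtain ⟨c2, hc2, hg2⟩ := ao_geo (2 - p) (by linarith)
  refine ⟨(4 ^ q * 2 ^ (p - q)) * c1 + 16 * c2, ?_, ?_⟩
  · refine ENNReal.add_ne_top.mpr ⟨ENNReal.mul_ne_top (ENNReal.mul_ne_top ?_ ?_) hc1,
      ENNReal.mul_ne_top (by norm_num) hc2⟩
    · exact ENNReal.rpow_ne_top_of_nonneg hq.le (by norm_num)
    · exact ENNReal.rpow_ne_top_of_nonneg (by linarith) (by norm_num)
  intro Q K1 K2 γ hγ0 hγt hsub h1 h2 f hfin
  classical
  set fg : ℤ → X → ℂ := fun k x => if γ * 2 ^ (k : ℝ) < (‖f x‖₊ : ℝ≥0∞) then f x else 0 with hfg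
  set fl : ℤ → X → ℂ := fun k x => if γ * 2 ^ (k : ℝ) < (‖f x‖₊ : ℝ≥0∞) then 0 else f x with hfl
  have hsum : ∀ k, fg k + fl k = f := by
    intro k; funext x
    simp only [hfg, hfl, Pi.add_apply]
    split_ifs <;> simp
  have hpt : ∀ x, Q f x ^ p ≤ (4 ^ q * 2 ^ (p - q)) *
        ∑' k : ℤ, (2 : ℝ≥0∞) ^ (k * (p - q)) * Q (fg k) x ^ q
      + 16 * ∑' k : ℤ, (2 : ℝ≥0∞) ^ (-k * (2 - p)) * Q (fl k) x ^ (2 : ℝ) := by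
    intro x
    refine ao_marc_pt hqp hq hp _ (hfin x) _ _ fun k => ?_
    have := hsub (fg k) (fl k) x
    rwa [hsum k] at this
  have hA : ∑' x, ∑' k : ℤ, (2 : ℝ≥0∞) ^ (k * (p - q)) * Q (fg k) x ^ q
      ≤ c1 * (K1 * γ ^ (q - p)) * ∑' x, (‖f x‖₊ : ℝ≥0∞) ^ p := by
    rw [ENNReal.tsum_comm]
    calc ∑' k : ℤ, ∑' x, (2 : ℝ≥0∞) ^ (k * (p - q)) * Q (fg k) x ^ q
        ≤ ∑' k : ℤ, (2 : ℝ≥0∞) ^ (k * (p - q)) * (K1 * ∑' x, (‖fg k x‖₊ : ℝ≥0∞) ^ q) := by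
          refine ENNReal.tsum_le_tsum fun k => ?_
          rw [ENNReal.tsum_mul_left]
          gcongr
          exact h1 _
      _ = K1 * ∑' x, ∑' k : ℤ, (2 : ℝ≥0∞) ^ (k * (p - q)) * (‖fg k x‖₊ : ℝ≥0∞) ^ q := by
          rw [ENNReal.tsum_comm, ← ENNReal.tsum_mul_left]
          refine tsum_congr fun k => ?_
          rw [ENNReal.tsum_mul_left]; ring
      _ ≤ K1 * ∑' x, c1 * γ ^ (q - p) * (‖f x‖₊ : ℝ≥0∞) ^ p := by
          gcongr with x
          set z : ℝ≥0∞ := (‖f x‖₊ : ℝ≥0∞) with hz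
          calc ∑' k : ℤ, (2 : ℝ≥0∞) ^ (k * (p - q)) * (‖fg k x‖₊ : ℝ≥0∞) ^ q
              ≤ ∑' k : ℤ, z ^ q * (if (2 : ℝ≥0∞) ^ (k : ℝ) ≤ z / γ then
                  (2 : ℝ≥0∞) ^ (k * (p - q)) else 0) := by
                refine ENNReal.tsum_le_tsum fun k => ?_
                by_cases hk : γ * 2 ^ (k : ℝ) < z
                · have h3 : (2 : ℝ≥0∞) ^ (k : ℝ) ≤ z / γ := by
                    rw [ENNReal.le_div_iff_mul_le (Or.inl hγ0) (Or.inl hγt), mul_comm]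
                    exact hk.le
                  rw [if_pos h3]
                  simp only [hfg]
                  rw [if_pos hk, mul_comm]
                · simp only [hfg]
                  rw [if_neg hk]
                  simp [ENNReal.zero_rpow_of_pos hq]
            _ = z ^ q * ∑' k : ℤ, (if (2 : ℝ≥0∞) ^ (k : ℝ) ≤ z / γ then
                  (2 : ℝ≥0∞) ^ (k * (p - q)) else 0) := ENNReal.tsum_mul_left
            _ ≤ z ^ q * (c1 * (z / γ) ^ (p - q)) := by gcongr; exact hg1 _
            _ = c1 * γ ^ (q - p) * z ^ p := by
                have e1 : z ^ p = z ^ q * z ^ (p - q) := by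
                  rw [← ENNReal.rpow_add_of_nonneg _ _ hq.le (by linarith)]; congr 1; ring
                have e2 : γ ^ (q - p) = (γ ^ (p - q))⁻¹ := by
                  rw [← ENNReal.rpow_neg]; congr 1; ring
                rw [e1, e2, ENNReal.div_rpow_of_nonneg _ _ (by linarith), div_eq_mul_inv]; ring
      _ = _ := by rw [ENNReal.tsum_mul_left]; ring
  have hB : ∑' x, ∑' k : ℤ, (2 : ℝ≥0∞) ^ (-k * (2 - p)) * Q (fl k) x ^ (2 : ℝ)
      ≤ c2 * (K2 * γ ^ (2 - p)) * ∑' x, (‖f x‖₊ : ℝ≥0∞) ^ p := by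
    rw [ENNReal.tsum_comm]
    calc ∑' k : ℤ, ∑' x, (2 : ℝ≥0∞) ^ (-k * (2 - p)) * Q (fl k) x ^ (2 : ℝ)
        ≤ ∑' k : ℤ, (2 : ℝ≥0∞) ^ (-k * (2 - p)) * (K2 * ∑' x, (‖fl k x‖₊ : ℝ≥0∞) ^ (2 : ℝ)) := by
          refine ENNReal.tsum_le_tsum fun k => ?_
          rw [ENNReal.tsum_mul_left]
          gcongr
          exact h2 _
      _ = K2 * ∑' x, ∑' k : ℤ, (2 : ℝ≥0∞) ^ (-k * (2 - p)) * (‖fl k x‖₊ : ℝ≥0∞) ^ (2 : ℝ) := by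
          rw [ENNReal.tsum_comm, ← ENNReal.tsum_mul_left]
          refine tsum_congr fun k => ?_
          rw [ENNReal.tsum_mul_left]; ring
      _ ≤ K2 * ∑' x, c2 * γ ^ (2 - p) * (‖f x‖₊ : ℝ≥0∞) ^ p := by
          gcongr with x
          set z : ℝ≥0∞ := (‖f x‖₊ : ℝ≥0∞) with hz
          have hzt : z ≠ ⊤ := ENNReal.coe_ne_top
          calc ∑' k : ℤ, (2 : ℝ≥0∞) ^ (-k * (2 - p)) * (‖fl k x‖₊ : ℝ≥0∞) ^ (2 : ℝ)
              ≤ ∑' k : ℤ, z ^ (2 : ℝ) * (if (2 : ℝ≥0∞) ^ ((-k : ℤ) : ℝ) ≤ γ / z then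
                  (2 : ℝ≥0∞) ^ (((-k : ℤ) : ℝ) * (2 - p)) else 0) := by
                refine ENNReal.tsum_le_tsum fun k => ?_
                by_cases hk : γ * 2 ^ (k : ℝ) < z
                · simp only [hfl]
                  rw [if_pos hk]
                  simp
                · have h3 : (2 : ℝ≥0∞) ^ ((-k : ℤ) : ℝ) ≤ γ / z := by
                    push Not at hk
                    rw [Int.cast_neg, ENNReal.rpow_neg]
                    rw [ENNReal.le_div_iff_mul_le (Or.inr hγ0) (Or.inl hzt)]
                    rw [mul_comm, ← div_eq_mul_inv]
                    exact ENNReal.div_le_of_le_mul hk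
                  rw [if_pos h3]
                  simp only [hfl]
                  rw [if_neg hk, mul_comm, Int.cast_neg]
            _ = z ^ (2 : ℝ) * ∑' k : ℤ, (if (2 : ℝ≥0∞) ^ (k : ℝ) ≤ γ / z then
                  (2 : ℝ≥0∞) ^ (k * (2 - p)) else 0) := by
                rw [ENNReal.tsum_mul_left]
                congr 1
                exact (Equiv.neg ℤ).tsum_eq (fun k : ℤ => if (2 : ℝ≥0∞) ^ (k : ℝ) ≤ γ / z then
                  (2 : ℝ≥0∞) ^ (k * (2 - p)) else 0)
            _ ≤ z ^ (2 : ℝ) * (c2 * (γ / z) ^ (2 - p)) := by gcongr; exact hg2 _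
            _ ≤ c2 * γ ^ (2 - p) * z ^ p := by
                rcases eq_or_ne z 0 with h0 | h0
                · rw [h0]; simp
                have e1 : z ^ p = z ^ (2 : ℝ) * (z ^ (2 - p))⁻¹ := by
                  rw [← ENNReal.rpow_neg, ← ENNReal.rpow_add _ _ h0 hzt]; congr 1; ring
                rw [e1, ENNReal.div_rpow_of_nonneg _ _ (by linarith), div_eq_mul_inv]
                apply le_of_eq; ring
      _ = _ := by rw [ENNReal.tsum_mul_left]; ring
  calc ∑' x, Q f x ^ p ≤ ∑' x, ((4 ^ q * 2 ^ (p - q)) *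
        ∑' k : ℤ, (2 : ℝ≥0∞) ^ (k * (p - q)) * Q (fg k) x ^ q
      + 16 * ∑' k : ℤ, (2 : ℝ≥0∞) ^ (-k * (2 - p)) * Q (fl k) x ^ (2 : ℝ)) :=
        ENNReal.tsum_le_tsum hpt
    _ = (4 ^ q * 2 ^ (p - q)) *
        ∑' x, ∑' k : ℤ, (2 : ℝ≥0∞) ^ (k * (p - q)) * Q (fg k) x ^ q
      + 16 * ∑' x, ∑' k : ℤ, (2 : ℝ≥0∞) ^ (-k * (2 - p)) * Q (fl k) x ^ (2 : ℝ) := by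
        rw [ENNReal.tsum_add, ENNReal.tsum_mul_left, ENNReal.tsum_mul_left]
    _ ≤ (4 ^ q * 2 ^ (p - q)) * (c1 * (K1 * γ ^ (q - p)) * ∑' x, (‖f x‖₊ : ℝ≥0∞) ^ p)
      + 16 * (c2 * (K2 * γ ^ (2 - p)) * ∑' x, (‖f x‖₊ : ℝ≥0∞) ^ p) := by gcongr
    _ = ((4 ^ q * 2 ^ (p - q)) * c1 * (K1 * γ ^ (q - p)) + 16 * c2 * (K2 * γ ^ (2 - p))) *
          ∑' x, (‖f x‖₊ : ℝ≥0∞) ^ p := by ring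
    _ ≤ _ := by
        gcongr
        rw [mul_add]
        gcongr
        · exact le_self_add
        · exact le_add_self


lemma ao_marc' {X : Type*} {p q : ℝ} (hqp : q < p) (hq : 0 < q) (hp : p < 2) :
    ∃ C : ℝ≥0∞, C ≠ ⊤ ∧ ∀ (Q : (X → ℂ) → X → ℝ≥0∞) (K1 K2 : ℝ≥0∞), K1 ≠ 0 → K1 ≠ ⊤ →
      K2 ≠ 0 → K2 ≠ ⊤ →
      (∀ f g x, Q (f + g) x ≤ 2 * (Q f x + Q g x)) →
      (∀ f, ∑' x, Q f x ^ q ≤ K1 * ∑' x, (‖f x‖₊ : ℝ≥0∞) ^ q) →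
      (∀ f, ∑' x, Q f x ^ (2 : ℝ) ≤ K2 * ∑' x, (‖f x‖₊ : ℝ≥0∞) ^ (2 : ℝ)) →
      ∀ f, (∀ x, Q f x ≠ ⊤) → ∑' x, Q f x ^ p ≤
        C * (K1 ^ ((2 - p) / (2 - q)) * K2 ^ ((p - q) / (2 - q))) *
          ∑' x, (‖f x‖₊ : ℝ≥0∞) ^ p := by
  obtain ⟨C, hC, h⟩ := ao_marc (X := X) hqp hq hp
  refine ⟨C * 2, ENNReal.mul_ne_top hC (by norm_num), ?_⟩
  intro Q K1 K2 h10 h1t h20 h2t hsub h1 h2 f hf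
  have h2q : 0 < 2 - q := by linarith
  have hpw : ∀ e : ℝ, ((K1 / K2) ^ (1 / (2 - q))) ^ e = K1 ^ (e / (2 - q)) * K2 ^ (-(e / (2 - q))) := by
    intro e
    rw [← ENNReal.rpow_mul, div_eq_mul_inv K1, ENNReal.mul_rpow_of_ne_zero h10
      (ENNReal.inv_ne_zero.mpr h2t), ENNReal.inv_rpow, ← ENNReal.rpow_neg]
    congr 2 <;> ring
  have := h Q K1 K2 ((K1 / K2) ^ (1 / (2 - q)))
    (by
      refine (ENNReal.rpow_pos (ENNReal.div_pos h10 h2t) (ENNReal.div_ne_top h1t h20)).ne')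
    (ENNReal.rpow_ne_top_of_nonneg (by positivity) (ENNReal.div_ne_top h1t h20)) hsub h1 h2 f hf
  refine this.trans (le_of_eq ?_)
  have e1 : K1 * ((K1 / K2) ^ (1 / (2 - q))) ^ (q - p)
      = K1 ^ ((2 - p) / (2 - q)) * K2 ^ ((p - q) / (2 - q)) := by
    rw [hpw, ← mul_assoc]
    nth_rewrite 1 [← ENNReal.rpow_one K1]
    rw [← ENNReal.rpow_add _ _ h10 h1t]
    congr 2
    · field_simp; ring
    · field_simp; ring
  have e2 : K2 * ((K1 / K2) ^ (1 / (2 - q))) ^ (2 - p)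
      = K1 ^ ((2 - p) / (2 - q)) * K2 ^ ((p - q) / (2 - q)) := by
    rw [hpw, mul_left_comm]
    nth_rewrite 1 [← ENNReal.rpow_one K2]
    rw [← ENNReal.rpow_add _ _ h20 h2t]
    congr 2
    field_simp; ring
  rw [e1, e2]; ring

lemma ao_vec {X : Type*} (T L : ℝ → (X → ℂ) → X → ℂ) (D : ℤ → Set ℝ) {p s q : ℝ}
    (hs0 : 0 < s) (hs2 : s < 2) (hp0 : 0 < p) (hq : q = 2 * p / (p + 2 - s))
    (hold : ∀ n, ∀ t ∈ D n, ∀ (g : X → ℂ) (u v : X → ℝ), (∀ y, 0 ≤ u y) → (∀ y, 0 ≤ v y) →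
      (∀ y, ‖g y‖ ≤ u y ^ (s / 2) * v y ^ (1 - s / 2)) → ∀ x,
      (‖T t g x‖₊ : ℝ≥0∞) ≤ (‖L t (fun y => (u y : ℂ)) x‖₊ : ℝ≥0∞) ^ (s / 2) *
        (‖L t (fun y => (v y : ℂ)) x‖₊ : ℝ≥0∞) ^ (1 - s / 2))
    (Cs B : ℝ≥0∞)
    (hLs : ∀ n f, ∑' x, (⨆ t : D n, (‖L t f x‖₊ : ℝ≥0∞)) ^ s ≤
      Cs * ∑' x, (‖f x‖₊ : ℝ≥0∞) ^ s)
    (hLp : ∀ f, ∑' x, (⨆ n, ⨆ t : D n, (‖L t f x‖₊ : ℝ≥0∞)) ^ p ≤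
      B * ∑' x, (‖f x‖₊ : ℝ≥0∞) ^ p)
    (g : ℤ → X → ℂ) (hG : ∀ x, ∑' n, (‖g n x‖₊ : ℝ≥0∞) ^ 2 ≠ ⊤) :
    ∑' x, ((∑' n, ⨆ t : D n, (‖T t (g n) x‖₊ : ℝ≥0∞) ^ 2) ^ (1 / 2 : ℝ)) ^ q ≤
      Cs ^ (q / 2) * B ^ (1 - q / 2) *
        ∑' x, ((∑' n, (‖g n x‖₊ : ℝ≥0∞) ^ 2) ^ (1 / 2 : ℝ)) ^ q := by
  have hden : 0 < p + 2 - s := by linarith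
  have hq0 : 0 < q := by rw [hq]; positivity
  have hq2 : q < 2 := by rw [hq, div_lt_iff₀ hden]; linarith
  set E : X → ℝ≥0∞ := fun x => ∑' n, (‖g n x‖₊ : ℝ≥0∞) ^ 2 with hE
  set e : X → ℝ := fun x => (E x).toReal with he
  have he0 : ∀ x, 0 ≤ e x := fun x => ENNReal.toReal_nonneg
  have hEe : ∀ x, E x = ENNReal.ofReal (e x) := fun x => (ENNReal.ofReal_toReal (hG x)).symm
  set θ : ℝ := 1 - s / 2 with hθ
  have hθ0 : 0 < θ := by rw [hθ]; linarith
  have hα : 1 - θ * (q / p) = q / 2 := by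
    rw [hθ, hq]; field_simp; ring
  set v : X → ℝ := fun x => e x ^ (q / p / 2) with hv
  set u : ℤ → X → ℝ := fun n x => ‖g n x‖ ^ (2 / s) * e x ^ (-(θ * (q / p) / s)) with hu
  have hv0 : ∀ x, 0 ≤ v x := fun x => Real.rpow_nonneg (he0 x) _
  have hu0 : ∀ n x, 0 ≤ u n x := fun n x =>
    mul_nonneg (Real.rpow_nonneg (norm_nonneg _) _) (Real.rpow_nonneg (he0 x) _)
  have hg0 : ∀ n x, e x = 0 → g n x = 0 := by
    intro n x hx
    have : E x = 0 := by rw [hEe, hx]; simp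
    rw [hE] at this
    have := (ENNReal.tsum_eq_zero.mp this) n
    simpa using this
  have hfac : ∀ n y, ‖g n y‖ ≤ u n y ^ (s / 2) * v y ^ θ := by
    intro n y
    rcases (he0 y).eq_or_lt with h | h
    · rw [hg0 n y h.symm]
      simpa using mul_nonneg (Real.rpow_nonneg (hu0 n y) _) (Real.rpow_nonneg (hv0 y) _)
    · apply le_of_eq
      simp only [hu, hv]
      rw [Real.mul_rpow (Real.rpow_nonneg (norm_nonneg _) _) (Real.rpow_nonneg (he0 y) _),
        ← Real.rpow_mul (norm_nonneg _), ← Real.rpow_mul (he0 y), ← Real.rpow_mul (he0 y),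
        mul_assoc, ← Real.rpow_add h]
      have a1 : 2 / s * (s / 2) = 1 := by field_simp
      have a2 : -(θ * (q / p) / s) * (s / 2) + q / p / 2 * θ = 0 := by field_simp; ring
      rw [a1, a2]; simp
  have hun : ∀ x, ∑' n, (‖((u n x : ℝ) : ℂ)‖₊ : ℝ≥0∞) ^ s ≤ E x ^ (q / 2) := by
    intro x
    have hcoe : ∀ n, (‖((u n x : ℝ) : ℂ)‖₊ : ℝ≥0∞) ^ s = ENNReal.ofReal (u n x ^ s) := by
      intro n
      rw [← ENNReal.ofReal_rpow_of_nonneg (hu0 n x) hs0.le]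
      congr 1
      rw [← enorm_eq_nnnorm, ← ofReal_norm, Complex.norm_real, Real.norm_of_nonneg (hu0 n x)]
    rcases (he0 x).eq_or_lt with h | h
    · have : ∀ n, u n x = 0 := by
        intro n
        simp only [hu]
        rw [hg0 n x h.symm, norm_zero, Real.zero_rpow (by positivity), zero_mul]
      simp [this, hs0]
    · have hEx0 : E x ≠ 0 := by rw [hEe]; simpa using h
      have h3 : ∀ n, ENNReal.ofReal (u n x ^ s)
          = (‖g n x‖₊ : ℝ≥0∞) ^ 2 * E x ^ (-(θ * (q / p))) := by
        intro n
        rw [hEe, ENNReal.ofReal_rpow_of_pos h, ← enorm_eq_nnnorm, ← ofReal_norm,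
          ← ENNReal.ofReal_pow (norm_nonneg _), ← ENNReal.ofReal_mul (by positivity)]
        congr 1
        simp only [hu]
        rw [Real.mul_rpow (Real.rpow_nonneg (norm_nonneg _) _) (Real.rpow_nonneg (he0 x) _),
          ← Real.rpow_mul (norm_nonneg _), ← Real.rpow_mul (he0 x)]
        have a1 : 2 / s * s = 2 := by field_simp
        have a2 : -(θ * (q / p) / s) * s = -(θ * (q / p)) := by field_simp
        rw [a1, a2, Real.rpow_two]
      simp_rw [hcoe, h3]
      rw [ENNReal.tsum_mul_right]
      change E x * _ ≤ _
      nth_rewrite 1 [← ENNReal.rpow_one (E x)]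
      rw [← ENNReal.rpow_add _ _ hEx0 (hG x), ← hα, sub_eq_add_neg]
  have hvp : ∀ x, (‖((v x : ℝ) : ℂ)‖₊ : ℝ≥0∞) ^ p = E x ^ (q / 2) := by
    intro x
    rw [← enorm_eq_nnnorm, ← ofReal_norm, Complex.norm_real, Real.norm_of_nonneg (hv0 x), hEe,
      ENNReal.ofReal_rpow_of_nonneg (hv0 x) hp0.le,
      ENNReal.ofReal_rpow_of_nonneg (he0 x) (by positivity)]
    simp only [hv]
    rw [← Real.rpow_mul (he0 x)]
    congr 2; field_simp
  set a : X → ℝ≥0∞ := fun x => ∑' n, (⨆ t : D n, (‖L t (fun y => (u n y : ℂ)) x‖₊ : ℝ≥0∞)) ^ s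
    with ha
  set c : X → ℝ≥0∞ := fun x => ⨆ n, ⨆ t : D n, (‖L t (fun y => (v y : ℂ)) x‖₊ : ℝ≥0∞) with hc
  have hpt : ∀ x, ∑' n, ⨆ t : D n, (‖T t (g n) x‖₊ : ℝ≥0∞) ^ 2 ≤ a x * c x ^ (2 * θ) := by
    intro x
    rw [ha]
    simp only
    rw [← ENNReal.tsum_mul_right]
    refine ENNReal.tsum_le_tsum fun n => iSup_le fun t => ?_
    have h1 := hold n t t.2 (g n) (u n) v (hu0 n) hv0 (hfac n) x
    calc (‖T t (g n) x‖₊ : ℝ≥0∞) ^ 2 ≤ ((‖L t (fun y => (u n y : ℂ)) x‖₊ : ℝ≥0∞) ^ (s / 2) *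
        (‖L t (fun y => (v y : ℂ)) x‖₊ : ℝ≥0∞) ^ θ) ^ 2 := by gcongr
      _ = (‖L t (fun y => (u n y : ℂ)) x‖₊ : ℝ≥0∞) ^ s *
        (‖L t (fun y => (v y : ℂ)) x‖₊ : ℝ≥0∞) ^ (2 * θ) := by
          rw [mul_pow, ← ENNReal.rpow_mul_natCast, ← ENNReal.rpow_mul_natCast]
          congr 2 <;> push_cast <;> ring
      _ ≤ _ := by
          gcongr
          · exact le_iSup (fun t : D n => (‖L t (fun y => (u n y : ℂ)) x‖₊ : ℝ≥0∞)) t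
          · exact (le_iSup (fun t : D n => (‖L t (fun y => (v y : ℂ)) x‖₊ : ℝ≥0∞)) t).trans
              (le_iSup (fun n => ⨆ t : D n, (‖L t (fun y => (v y : ℂ)) x‖₊ : ℝ≥0∞)) n)
  have hconj : (2 / q).HolderConjugate (2 / (2 - q)) := by
    rw [Real.holderConjugate_iff]
    refine ⟨by rw [lt_div_iff₀ hq0]; linarith, ?_⟩
    have : (2 - q) ≠ 0 := by linarith
    field_simp; ring
  have hEq : ∀ x, (E x ^ (1 / 2 : ℝ)) ^ q = E x ^ (q / 2) := by
    intro x; rw [← ENNReal.rpow_mul]; congr 1; ring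
  have hsa : ∑' x, a x ≤ Cs * ∑' x, E x ^ (q / 2) := by
    rw [ha, ENNReal.tsum_comm]
    calc _ ≤ ∑' n, Cs * ∑' x, (‖((u n x : ℝ) : ℂ)‖₊ : ℝ≥0∞) ^ s :=
          ENNReal.tsum_le_tsum fun n => hLs n _
      _ = Cs * ∑' x, ∑' n, (‖((u n x : ℝ) : ℂ)‖₊ : ℝ≥0∞) ^ s := by
          rw [ENNReal.tsum_mul_left, ENNReal.tsum_comm]
      _ ≤ _ := by gcongr with x; exact hun x
  have hsc : ∑' x, c x ^ p ≤ B * ∑' x, E x ^ (q / 2) := by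
    refine (hLp _).trans ?_
    simp_rw [hvp]
    exact le_rfl
  change _ ≤ _ * ∑' x, (E x ^ (1 / 2 : ℝ)) ^ q
  simp_rw [hEq]
  have hθq : 2 * θ * (1 / 2) * q * (2 / (2 - q)) = p := by
    have h4 : 2 - q = 2 * (θ * (q / p)) := by linarith
    rw [h4]; field_simp
  calc ∑' x, ((∑' n, ⨆ t : D n, (‖T t (g n) x‖₊ : ℝ≥0∞) ^ 2) ^ (1 / 2 : ℝ)) ^ q
      ≤ ∑' x, a x ^ (q / 2) * c x ^ (2 * θ * (1 / 2) * q) := by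
        refine ENNReal.tsum_le_tsum fun x => ?_
        calc _ ≤ ((a x * c x ^ (2 * θ)) ^ (1 / 2 : ℝ)) ^ q := by gcongr; exact hpt x
          _ = _ := by
            rw [← ENNReal.rpow_mul, ENNReal.mul_rpow_of_nonneg _ _ (by positivity),
              ← ENNReal.rpow_mul]
            congr 2 <;> ring
    _ ≤ (∑' x, (a x ^ (q / 2)) ^ (2 / q)) ^ (1 / (2 / q)) *
        (∑' x, (c x ^ (2 * θ * (1 / 2) * q)) ^ (2 / (2 - q))) ^ (1 / (2 / (2 - q))) :=
        ao_holder _ _ hconj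
    _ = (∑' x, a x) ^ (q / 2) * (∑' x, c x ^ p) ^ (1 - q / 2) := by
        have a1 : q / 2 * (2 / q) = 1 := by field_simp
        have a2 : 1 / (2 / q) = q / 2 := by field_simp
        have a3 : 1 / (2 / (2 - q)) = 1 - q / 2 := by
          have : (2 - q) ≠ 0 := by linarith
          field_simp
        simp_rw [← ENNReal.rpow_mul, hθq, a1, a2, a3, ENNReal.rpow_one]
    _ ≤ (Cs * ∑' x, E x ^ (q / 2)) ^ (q / 2) * (B * ∑' x, E x ^ (q / 2)) ^ (1 - q / 2) := by
        gcongr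
        linarith
    _ = _ := by
        rw [ENNReal.mul_rpow_of_nonneg _ _ (by positivity),
          ENNReal.mul_rpow_of_nonneg _ _ (by linarith)]
        have : ∑' x, E x ^ (q / 2) = (∑' x, E x ^ (q / 2)) ^ (q / 2)
            * (∑' x, E x ^ (q / 2)) ^ (1 - q / 2) := by
          rw [← ENNReal.rpow_add_of_nonneg _ _ (by positivity) (by linarith)]; simp
        nth_rewrite 3 [this]
        ring

lemma ao_lbound {X : Type*} (a h l : X → ℝ≥0∞) (p : ℝ) (hp : 0 ≤ p) (hl : ∀ x, l x ≤ a x + 2 * h x)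
    (A B N : ℝ≥0∞) (ha : ∑' x, a x ^ p ≤ A * N) (hh : ∑' x, h x ^ p ≤ B * N) :
    ∑' x, l x ^ p ≤ 2 ^ p * (A + 2 ^ p * B) * N := by
  calc ∑' x, l x ^ p ≤ ∑' x, 2 ^ p * (a x ^ p + 2 ^ p * h x ^ p) := by
        refine ENNReal.tsum_le_tsum fun x => ?_
        calc l x ^ p ≤ (a x + 2 * h x) ^ p := by gcongr; exact hl x
          _ ≤ 2 ^ p * (a x ^ p + (2 * h x) ^ p) :=
            ENNReal.add_rpow_le_two_rpow_mul_rpow_add_rpow _ _ hp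
          _ = _ := by rw [ENNReal.mul_rpow_of_nonneg _ _ hp]
    _ = 2 ^ p * (∑' x, a x ^ p + 2 ^ p * ∑' x, h x ^ p) := by
        rw [ENNReal.tsum_mul_left, ENNReal.tsum_add, ENNReal.tsum_mul_left]
    _ ≤ 2 ^ p * (A * N + 2 ^ p * (B * N)) := by gcongr
    _ = _ := by ring

lemma ao_sub (A B : ℝ≥0∞) : (2 * (A + B)) ^ (1 / 2 : ℝ) ≤ 2 * (A ^ (1 / 2 : ℝ) + B ^ (1 / 2 : ℝ)) := by
  have h4 : (4 : ℝ≥0∞) ^ (1 / 2 : ℝ) = 2 := by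
    have : (4 : ℝ≥0∞) = 2 ^ (2 : ℝ) := by rw [ENNReal.rpow_two]; norm_num
    rw [this, ← ENNReal.rpow_mul]; simp
  calc (2 * (A + B)) ^ (1 / 2 : ℝ) ≤ (4 * (A + B)) ^ (1 / 2 : ℝ) := by
        gcongr; norm_num
    _ = 2 * (A + B) ^ (1 / 2 : ℝ) := by rw [ENNReal.mul_rpow_of_nonneg _ _ (by norm_num), h4]
    _ ≤ _ := by
        gcongr
        exact ENNReal.rpow_add_le_add_rpow _ _ (by norm_num) (by norm_num)

lemma ao_l2 {X : Type*} {p : ℝ} (hp0 : 0 < p) (hp2 : p ≤ 2) (f : X → ℂ)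
    (hf : ∑' x, (‖f x‖₊ : ℝ≥0∞) ^ p ≠ ⊤) : ∑' x, (‖f x‖₊ : ℝ≥0∞) ^ (2 : ℝ) ≠ ⊤ := by
  have h := ao_tsum_rpow (fun x => (‖f x‖₊ : ℝ≥0∞) ^ (2 : ℝ)) (r := p / 2) (by positivity) (by linarith)
  have e : ∀ x, ((‖f x‖₊ : ℝ≥0∞) ^ (2 : ℝ)) ^ (p / 2) = (‖f x‖₊ : ℝ≥0∞) ^ p := by
    intro x; rw [← ENNReal.rpow_mul]; congr 1; ring
  simp_rw [e] at h
  intro ht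
  rw [ht, ENNReal.top_rpow_of_pos (by positivity)] at h
  exact hf (top_le_iff.mp h)

lemma ao_Qj {X : Type*} (U : Set ℝ) (T L H : ℝ → (X → ℂ) → X → ℂ) (D0 : ℤ → Set ℝ)
    (hD0 : ∀ n, D0 n ⊆ U) (p₀ : ℝ) (hp₀ : 1 < p₀)
    (hTlin : ∀ t ∈ U, IsLinearMap ℂ (T t))
    (hold : ∀ s : ℝ, 0 < s → s < 2 → ∀ t ∈ U, ∀ (g : X → ℂ) (u v : X → ℝ),
      (∀ y, 0 ≤ u y) → (∀ y, 0 ≤ v y) →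
      (∀ y, ‖g y‖ ≤ u y ^ (s / 2) * v y ^ (1 - s / 2)) → ∀ x,
      (‖T t g x‖₊ : ℝ≥0∞) ≤ (‖L t (fun y => (u y : ℂ)) x‖₊ : ℝ≥0∞) ^ (s / 2) *
        (‖L t (fun y => (v y : ℂ)) x‖₊ : ℝ≥0∞) ^ (1 - s / 2))
    (hL : ∀ t ∈ U, ∀ f x, (‖L t f x‖₊ : ℝ≥0∞) ≤ ‖T t f x‖₊ + 2 * (‖H t f x‖₊ : ℝ≥0∞))
    (hH : ∀ p : ℝ, 1 < p → p ≤ 2 → ∃ C : ℝ≥0∞, C ≠ ⊤ ∧ ∀ f : X → ℂ,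
      ∑' x, (⨆ t : U, (‖H t f x‖₊ : ℝ≥0∞)) ^ p ≤ C * ∑' x, (‖f x‖₊ : ℝ≥0∞) ^ p)
    (hT : ∀ p : ℝ, p₀ < p → p ≤ 2 → ∃ C : ℝ≥0∞, C ≠ ⊤ ∧ ∀ n, ∀ f : X → ℂ,
      ∑' x, (⨆ t : D0 n, (‖T t f x‖₊ : ℝ≥0∞)) ^ p ≤ C * ∑' x, (‖f x‖₊ : ℝ≥0∞) ^ p)
    (S : ℤ → (X → ℂ) → X → ℂ) (hSlin : ∀ n, IsLinearMap ℂ (S n))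
    (hSLP : ∀ p : ℝ, 1 < p → ∃ C : ℝ≥0∞, C ≠ ⊤ ∧ ∀ f : X → ℂ,
      ∑' x, ((∑' n, (‖S n f x‖₊ : ℝ≥0∞) ^ 2) ^ (1 / 2 : ℝ)) ^ p ≤
        C * ∑' x, (‖f x‖₊ : ℝ≥0∞) ^ p)
    (β : ℤ → ℝ≥0∞) (hβ0 : ∀ j, β j ≠ 0) (hβt : ∀ j, β j ≠ ⊤)
    (hTS : ∀ j, ∀ f : X → ℂ,
      ∑' x, ((∑' n, ⨆ t : D0 n, (‖T t (S (j + n) f) x‖₊ : ℝ≥0∞) ^ 2) ^ (1 / 2 : ℝ)) ^ (2 : ℝ) ≤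
        β j ^ (2 : ℝ) * ∑' x, (‖f x‖₊ : ℝ≥0∞) ^ (2 : ℝ))
    (p : ℝ) (hp1 : p₀ < p) (hp2 : p ≤ 2) :
    ∃ C : ℝ≥0∞, C ≠ ⊤ ∧ ∃ σ : ℝ, 0 < σ ∧ ∀ (D : ℤ → Set ℝ), (∀ n, D n ⊆ D0 n) →
      ∀ B : ℝ≥0∞, 1 ≤ B → B ≠ ⊤ →
      (∀ f : X → ℂ, ∑' x, (⨆ n, ⨆ t : D n, (‖T t f x‖₊ : ℝ≥0∞)) ^ p ≤
        B * ∑' x, (‖f x‖₊ : ℝ≥0∞) ^ p) →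
      ∀ j, ∀ f : X → ℂ, ∑' x, (‖f x‖₊ : ℝ≥0∞) ^ p ≠ ⊤ →
      ∑' x, ((∑' n, ⨆ t : D n, (‖T t (S (j + n) f) x‖₊ : ℝ≥0∞) ^ 2) ^ (1 / 2 : ℝ)) ^ p ≤
        C * B ^ (1 - p / 2) * β j ^ σ * ∑' x, (‖f x‖₊ : ℝ≥0∞) ^ p := by
  have hp0 : 0 < p := by linarith
  have hmono : ∀ D : ℤ → Set ℝ, (∀ n, D n ⊆ D0 n) → ∀ j, ∀ f : X → ℂ,
      ∑' x, ((∑' n, ⨆ t : D n, (‖T t (S (j + n) f) x‖₊ : ℝ≥0∞) ^ 2) ^ (1 / 2 : ℝ)) ^ (2 : ℝ) ≤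
        β j ^ (2 : ℝ) * ∑' x, (‖f x‖₊ : ℝ≥0∞) ^ (2 : ℝ) := by
    intro D hD j f
    refine le_trans ?_ (hTS j f)
    gcongr with x n
    exact iSup_le fun t => le_iSup (fun t : D0 n => (‖T t (S (j + n) f) x‖₊ : ℝ≥0∞) ^ 2)
      ⟨t, hD n t.2⟩
  rcases hp2.eq_or_lt with rfl | hp2'
  · refine ⟨1, by simp, 2, by norm_num, ?_⟩
    intro D hD B hB1 hBt hval j f hf
    simpa using hmono D hD j f
  set s : ℝ := (p₀ + p) / 2 with hs
  have hs0 : p₀ < s := by rw [hs]; linarith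
  have hsp : s < p := by rw [hs]; linarith
  set q : ℝ := 2 * p / (p + 2 - s) with hq
  have hden : 0 < p + 2 - s := by linarith
  have hq1 : 1 < q := by rw [hq, lt_div_iff₀ hden]; linarith
  have hqp : q < p := by
    rw [hq, div_lt_iff₀ hden]
    nlinarith
  have hq0 : 0 < q := by linarith
  have hq2 : q < 2 := by linarith
  obtain ⟨CTs, hCTs, hTs⟩ := hT s hs0 (by linarith)
  obtain ⟨CHs, hCHs, hHs⟩ := hH s (by linarith) (by linarith)
  obtain ⟨CHp, hCHp, hHp⟩ := hH p (by linarith) (by linarith)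
  obtain ⟨CS, hCS, hS⟩ := hSLP q hq1
  obtain ⟨CM, hCM, hM⟩ := ao_marc' (X := X) hqp hq0 hp2'
  have h2s : (2 : ℝ≥0∞) ^ s ≠ ⊤ := ENNReal.rpow_ne_top_of_nonneg (by linarith) (by norm_num)
  have h2p : (2 : ℝ≥0∞) ^ p ≠ ⊤ := ENNReal.rpow_ne_top_of_nonneg (by linarith) (by norm_num)
  set CLs : ℝ≥0∞ := 2 ^ s * (CTs + 2 ^ s * CHs) with hCLs
  have hCLst : CLs ≠ ⊤ := ENNReal.mul_ne_top h2s (ENNReal.add_ne_top.mpr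
    ⟨hCTs, ENNReal.mul_ne_top h2s hCHs⟩)
  set CLp : ℝ≥0∞ := 2 ^ p * (1 + 2 ^ p * CHp) with hCLp
  have hCLpt : CLp ≠ ⊤ := ENNReal.mul_ne_top h2p (ENNReal.add_ne_top.mpr
    ⟨by simp, ENNReal.mul_ne_top h2p hCHp⟩)
  set Cq : ℝ≥0∞ := CLs ^ (q / 2) * CLp ^ (1 - q / 2) * CS + 1 with hCq
  have hCqt : Cq ≠ ⊤ := by
    refine ENNReal.add_ne_top.mpr ⟨ENNReal.mul_ne_top (ENNReal.mul_ne_top ?_ ?_) hCS, by simp⟩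
    · exact ENNReal.rpow_ne_top_of_nonneg (by linarith) hCLst
    · exact ENNReal.rpow_ne_top_of_nonneg (by linarith) hCLpt
  have hCq0 : Cq ≠ 0 := by rw [hCq]; simp
  refine ⟨CM * Cq ^ ((2 - p) / (2 - q)), ENNReal.mul_ne_top hCM
    (ENNReal.rpow_ne_top_of_nonneg (div_nonneg (by linarith) (by linarith)) hCqt),
    2 * ((p - q) / (2 - q)), mul_pos (by norm_num) (div_pos (by linarith) (by linarith)), ?_⟩
  intro D hD B hB1 hBt hval j f hf
  have hB0 : B ≠ 0 := (lt_of_lt_of_le one_pos hB1).ne'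
  have hDU : ∀ n, D n ⊆ U := fun n => (hD n).trans (hD0 n)
  have hLs : ∀ n (f : X → ℂ), ∑' x, (⨆ t : D n, (‖L t f x‖₊ : ℝ≥0∞)) ^ s ≤
      CLs * ∑' x, (‖f x‖₊ : ℝ≥0∞) ^ s := by
    intro n f
    refine ao_lbound _ _ _ s (by linarith) (fun x => ?_) _ _ _ (hTs n f) (hHs f)
    refine iSup_le fun t => (hL t (hDU n t.2) f x).trans ?_
    gcongr
    · exact le_iSup (fun t : D0 n => (‖T t f x‖₊ : ℝ≥0∞)) ⟨t, hD n t.2⟩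
    · exact le_iSup (fun t : U => (‖H t f x‖₊ : ℝ≥0∞)) ⟨t, hDU n t.2⟩
  have hLp : ∀ (f : X → ℂ), ∑' x, (⨆ n, ⨆ t : D n, (‖L t f x‖₊ : ℝ≥0∞)) ^ p ≤
      (CLp * B) * ∑' x, (‖f x‖₊ : ℝ≥0∞) ^ p := by
    intro f
    refine (ao_lbound _ _ _ p (by linarith) (fun x => ?_) _ _ _ (hval f) (hHp f)).trans ?_
    · refine iSup_le fun n => iSup_le fun t => (hL t (hDU n t.2) f x).trans ?_
      gcongr
      · exact (le_iSup (fun t : D n => (‖T t f x‖₊ : ℝ≥0∞)) t).trans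
          (le_iSup (fun n => ⨆ t : D n, (‖T t f x‖₊ : ℝ≥0∞)) n)
      · exact le_iSup (fun t : U => (‖H t f x‖₊ : ℝ≥0∞)) ⟨t, hDU n t.2⟩
    · refine mul_le_mul' ?_ le_rfl
      rw [hCLp, mul_assoc, add_mul, one_mul]
      refine mul_le_mul' le_rfl (add_le_add le_rfl ?_)
      exact le_mul_of_one_le_right' hB1
  set K1 : ℝ≥0∞ := Cq * B ^ (1 - q / 2) with hK1
  have hBq0 : B ^ (1 - q / 2) ≠ 0 :=
    (ENNReal.rpow_pos (pos_iff_ne_zero.mpr hB0) hBt).ne'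
  have hBqt : B ^ (1 - q / 2) ≠ ⊤ := ENNReal.rpow_ne_top_of_nonneg (by linarith) hBt
  have hshift : ∀ (f : X → ℂ) x, ∑' n, (‖S (j + n) f x‖₊ : ℝ≥0∞) ^ 2
      = ∑' n, (‖S n f x‖₊ : ℝ≥0∞) ^ 2 := fun f x =>
    (Equiv.addLeft j).tsum_eq (fun n => (‖S n f x‖₊ : ℝ≥0∞) ^ 2)
  have key := hM (fun f x => (∑' n, ⨆ t : D n, (‖T t (S (j + n) f) x‖₊ : ℝ≥0∞) ^ 2) ^ (1 / 2 : ℝ))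
    K1 (β j ^ (2 : ℝ)) (mul_ne_zero hCq0 hBq0) (ENNReal.mul_ne_top hCqt hBqt)
    (ENNReal.rpow_pos (pos_iff_ne_zero.mpr (hβ0 j)) (hβt j)).ne'
    (ENNReal.rpow_ne_top_of_nonneg (by norm_num) (hβt j)) ?_ ?_ (hmono D hD j) f ?_
  · refine key.trans (le_of_eq ?_)
    rw [hK1, ENNReal.mul_rpow_of_nonneg _ _ (div_nonneg (by linarith) (by linarith)),
      ← ENNReal.rpow_mul, ← ENNReal.rpow_mul]
    have : (1 - q / 2) * ((2 - p) / (2 - q)) = 1 - p / 2 := by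
      have : 2 - q ≠ 0 := by linarith
      field_simp
    rw [this]; ring
  · intro f g x
    refine le_trans ?_ (ao_sub _ _)
    refine ENNReal.rpow_le_rpow ?_ (by norm_num)
    rw [← ENNReal.tsum_add, ← ENNReal.tsum_mul_left]
    refine ENNReal.tsum_le_tsum fun n => iSup_le fun t => ?_
    rw [(hSlin (j + n)).map_add, (hTlin t (hDU n t.2)).map_add, Pi.add_apply]
    calc (‖T t (S (j + n) f) x + T t (S (j + n) g) x‖₊ : ℝ≥0∞) ^ 2
        ≤ 2 * ((‖T t (S (j + n) f) x‖₊ : ℝ≥0∞) ^ 2 + (‖T t (S (j + n) g) x‖₊ : ℝ≥0∞) ^ 2) := by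
          norm_cast
          calc _ ≤ (‖T t (S (j + n) f) x‖₊ + ‖T t (S (j + n) g) x‖₊) ^ 2 := by
                gcongr; exact nnnorm_add_le _ _
            _ ≤ _ := add_sq_le
      _ ≤ _ := by
          gcongr
          · exact le_iSup (fun t : D n => (‖T t (S (j + n) f) x‖₊ : ℝ≥0∞) ^ 2) t
          · exact le_iSup (fun t : D n => (‖T t (S (j + n) g) x‖₊ : ℝ≥0∞) ^ 2) t
  · intro f
    rcases eq_or_ne (∑' x, (‖f x‖₊ : ℝ≥0∞) ^ q) ⊤ with h | h
    · rw [h, ENNReal.mul_top (mul_ne_zero hCq0 hBq0)]; exact le_top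
    have hSf := hS f
    have hfin : ∀ x, ∑' n, (‖S (j + n) f x‖₊ : ℝ≥0∞) ^ 2 ≠ ⊤ := by
      intro x hx
      rw [hshift] at hx
      have h1 := (ENNReal.le_tsum x).trans hSf
      rw [hx, ENNReal.top_rpow_of_pos (by norm_num), ENNReal.top_rpow_of_pos hq0] at h1
      exact ENNReal.mul_ne_top hCS h (top_le_iff.mp h1)
    have hv := ao_vec T L D (p := p) (s := s) (q := q) (by linarith) (by linarith) hp0 hq
      (fun n t ht => hold s (by linarith) (by linarith) t (hDU n ht)) CLs (CLp * B) hLs hLp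
      (fun n => S (j + n) f) hfin
    refine hv.trans ?_
    simp_rw [hshift]
    calc _ ≤ CLs ^ (q / 2) * (CLp * B) ^ (1 - q / 2) * (CS * ∑' x, (‖f x‖₊ : ℝ≥0∞) ^ q) := by
          gcongr
      _ = (CLs ^ (q / 2) * CLp ^ (1 - q / 2) * CS) * B ^ (1 - q / 2) *
            ∑' x, (‖f x‖₊ : ℝ≥0∞) ^ q := by
          rw [ENNReal.mul_rpow_of_nonneg CLp B (by linarith : (0 : ℝ) ≤ 1 - q / 2)]; ring
      _ ≤ _ := by
          gcongr
          rw [hK1, hCq]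
          gcongr
          exact le_self_add
  · intro x hx
    have h1 := (ENNReal.le_tsum x).trans (hmono D hD j f)
    rw [hx, ENNReal.top_rpow_of_pos (by norm_num)] at h1
    exact ENNReal.mul_ne_top (ENNReal.rpow_ne_top_of_nonneg (by norm_num) (hβt j))
      (ao_l2 hp0 hp2 f hf) (top_le_iff.mp h1)

lemma ao_cs {ι : Type*} (c w : ι → ℝ≥0∞) (h0 : ∀ j, w j ≠ 0) (ht : ∀ j, w j ≠ ⊤) :
    (∑' j, c j) ^ 2 ≤ (∑' j, w j) * ∑' j, (w j)⁻¹ * c j ^ 2 := by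
  have h := ao_holder (fun j => w j ^ (1 / 2 : ℝ)) (fun j => w j ^ (-(1 / 2) : ℝ) * c j)
    (p := 2) (q := 2) ((Real.holderConjugate_iff).mpr ⟨by norm_num, by norm_num⟩)
  have e1 : ∀ j, w j ^ (1 / 2 : ℝ) * (w j ^ (-(1 / 2) : ℝ) * c j) = c j := by
    intro j
    rw [← mul_assoc, ← ENNReal.rpow_add _ _ (h0 j) (ht j)]; simp
  have e2 : ∀ j, (w j ^ (1 / 2 : ℝ)) ^ (2 : ℝ) = w j := by
    intro j; rw [← ENNReal.rpow_mul]; simp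
  have e3 : ∀ j, (w j ^ (-(1 / 2) : ℝ) * c j) ^ (2 : ℝ) = (w j)⁻¹ * c j ^ 2 := by
    intro j
    rw [ENNReal.mul_rpow_of_nonneg _ _ (by norm_num), ← ENNReal.rpow_mul, ENNReal.rpow_two]
    norm_num [ENNReal.rpow_neg_one]
  simp_rw [e1, e2, e3] at h
  calc (∑' j, c j) ^ 2 ≤ _ := pow_le_pow_left' h 2
    _ = _ := by
      rw [← ENNReal.rpow_two, ENNReal.mul_rpow_of_nonneg _ _ (by norm_num), ← ENNReal.rpow_mul,
        ← ENNReal.rpow_mul]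
      norm_num

lemma ao_sumj {X : Type*} (T : ℝ → (X → ℂ) → X → ℂ) (S : ℤ → (X → ℂ) → X → ℂ) (D : ℤ → Set ℝ)
    (p : ℝ) (hp0 : 0 < p) (hp2 : p ≤ 2) (β : ℤ → ℝ≥0∞) (hβ0 : ∀ j, β j ≠ 0) (hβt : ∀ j, β j ≠ ⊤)
    (σ : ℝ) (hσ : 0 < σ) (K : ℝ≥0∞) (f : X → ℂ)
    (hdec : ∀ n, ∀ t ∈ D n, ∀ x, (‖T t f x‖₊ : ℝ≥0∞) ≤ ∑' j, (‖T t (S (j + n) f) x‖₊ : ℝ≥0∞))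
    (hQ : ∀ j, ∑' x, ((∑' n, ⨆ t : D n, (‖T t (S (j + n) f) x‖₊ : ℝ≥0∞) ^ 2) ^ (1 / 2 : ℝ)) ^ p ≤
      K * β j ^ σ) :
    ∑' x, ((∑' n, ⨆ t : D n, (‖T t f x‖₊ : ℝ≥0∞) ^ 2) ^ (1 / 2 : ℝ)) ^ p ≤
      (∑' j, β j ^ (σ / p)) ^ (p / 2) * (∑' j, β j ^ (σ / 2)) * K := by
  set w : ℤ → ℝ≥0∞ := fun j => β j ^ (σ / p) with hw
  have hw0 : ∀ j, w j ≠ 0 := fun j => (ENNReal.rpow_pos (pos_iff_ne_zero.mpr (hβ0 j)) (hβt j)).ne'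
  have hwt : ∀ j, w j ≠ ⊤ := fun j => by
    simp only [hw]
    exact ENNReal.rpow_ne_top_of_nonneg (by positivity) (hβt j)
  set Aj : ℤ → X → ℝ≥0∞ := fun j x => ∑' n, ⨆ t : D n, (‖T t (S (j + n) f) x‖₊ : ℝ≥0∞) ^ 2
  have half : ∀ z : ℝ≥0∞, (z ^ (1 / 2 : ℝ)) ^ p = z ^ (p / 2) := by
    intro z; rw [← ENNReal.rpow_mul]; congr 1; ring
  simp_rw [half] at hQ ⊢
  have hpt : ∀ x, ∑' n, ⨆ t : D n, (‖T t f x‖₊ : ℝ≥0∞) ^ 2 ≤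
      (∑' j, w j) * ∑' j, (w j)⁻¹ * Aj j x := by
    intro x
    calc ∑' n, ⨆ t : D n, (‖T t f x‖₊ : ℝ≥0∞) ^ 2
        ≤ ∑' n, (∑' j, w j) * ∑' j, (w j)⁻¹ *
            ⨆ t : D n, (‖T t (S (j + n) f) x‖₊ : ℝ≥0∞) ^ 2 := by
          refine ENNReal.tsum_le_tsum fun n => iSup_le fun t => ?_
          refine (pow_le_pow_left' (hdec n t t.2 x) 2).trans ((ao_cs _ w hw0 hwt).trans ?_)
          gcongr with j
          exact le_iSup (fun t : D n => (‖T t (S (j + n) f) x‖₊ : ℝ≥0∞) ^ 2) t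
      _ = _ := by
          rw [ENNReal.tsum_mul_left, ENNReal.tsum_comm]
          simp_rw [ENNReal.tsum_mul_left]
          rfl
  calc _ ≤ ∑' x, ((∑' j, w j) * ∑' j, (w j)⁻¹ * Aj j x) ^ (p / 2) := by
        gcongr with x; exact hpt x
    _ ≤ ∑' x, (∑' j, w j) ^ (p / 2) * ∑' j, β j ^ (-(σ / 2)) * Aj j x ^ (p / 2) := by
        refine ENNReal.tsum_le_tsum fun x => ?_
        rw [ENNReal.mul_rpow_of_nonneg _ _ (by positivity)]
        gcongr
        refine (ao_tsum_rpow _ (by positivity) (by linarith)).trans (le_of_eq ?_)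
        refine tsum_congr fun j => ?_
        rw [ENNReal.mul_rpow_of_nonneg _ _ (by positivity)]
        simp only [hw]
        rw [← ENNReal.rpow_neg, ← ENNReal.rpow_mul]
        congr 2
        field_simp
    _ = (∑' j, w j) ^ (p / 2) * ∑' j, β j ^ (-(σ / 2)) * ∑' x, Aj j x ^ (p / 2) := by
        rw [ENNReal.tsum_mul_left, ENNReal.tsum_comm]
        simp_rw [ENNReal.tsum_mul_left]
    _ ≤ (∑' j, w j) ^ (p / 2) * ∑' j, β j ^ (-(σ / 2)) * (K * β j ^ σ) := by
        gcongr with j; exact hQ j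
    _ = (∑' j, w j) ^ (p / 2) * ∑' j, β j ^ (σ / 2) * K := by
        congr 1
        refine tsum_congr fun j => ?_
        have : β j ^ (σ / 2) = β j ^ (-(σ / 2)) * β j ^ σ := by
          rw [← ENNReal.rpow_add _ _ (hβ0 j) (hβt j)]; congr 1; ring
        rw [this]; ring
    _ = _ := by rw [ENNReal.tsum_mul_right, mul_assoc]

/-- Monotone limit of truncations. -/
lemma ao_mono {X : Type*} (g : ℕ → X → ℝ≥0∞) (hg : Monotone g) (p : ℝ) (hp : 0 < p) (K : ℝ≥0∞)
    (h : ∀ N, ∑' x, g N x ^ p ≤ K) : ∑' x, (⨆ N, g N x) ^ p ≤ K := by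
  let _ : MeasurableSpace X := ⊤
  have e : ∀ x, (⨆ N, g N x) ^ p = ⨆ N, g N x ^ p := fun x =>
    (ENNReal.orderIsoRpow p hp).map_iSup _
  simp_rw [e, ← lintegral_count' measurable_from_top]
  rw [lintegral_iSup (fun _ => measurable_from_top)
    (fun N N' hN x => ENNReal.rpow_le_rpow (hg hN x) hp.le)]
  refine iSup_le fun N => ?_
  rw [lintegral_count' measurable_from_top]
  exact h N

lemma ao_boot (η : ℝ) (h1 : η < 1) (C : ℝ≥0∞)
    (V : Set ℝ≥0∞) (hV1 : ∀ B ∈ V, 1 ≤ B) (hne : ∃ B ∈ V, B ≠ ⊤)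
    (hstep : ∀ B ∈ V, B ≠ ⊤ → C * B ^ η ∈ V) : ∃ B ∈ V, B ≤ (2 * C) ^ (1 / (1 - η)) := by
  obtain ⟨B0, hB0, hB0t⟩ := hne
  have hi1 : 1 ≤ sInf V := le_sInf hV1
  have hit : sInf V ≠ ⊤ := ((sInf_le hB0).trans_lt hB0t.lt_top).ne
  have hlt : sInf V < 2 * sInf V := by
    rw [two_mul]
    exact ENNReal.lt_add_right hit (lt_of_lt_of_le one_pos hi1).ne'
  obtain ⟨B, hB, hBlt⟩ := sInf_lt_iff.mp hlt
  have hBt : B ≠ ⊤ := ne_top_of_lt hBlt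
  have hBp : B ≠ 0 := (lt_of_lt_of_le one_pos (hV1 B hB)).ne'
  refine ⟨B, hB, ?_⟩
  have h2 : B ≤ 2 * (C * B ^ η) := hBlt.le.trans (by gcongr; exact sInf_le (hstep B hB hBt))
  have h3 : B ^ (1 - η) ≤ 2 * C := by
    rw [ENNReal.rpow_sub _ _ hBp hBt, ENNReal.rpow_one]
    refine ENNReal.div_le_of_le_mul (h2.trans (le_of_eq (by ring)))
  rw [one_div, ENNReal.le_rpow_inv_iff (by linarith)]
  exact h3

lemma ao_main {X : Type*} (U : Set ℝ) (T L H : ℝ → (X → ℂ) → X → ℂ) (D0 : ℤ → Set ℝ)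
    (hD0 : ∀ n, D0 n ⊆ U) (p₀ : ℝ) (hp₀ : 1 < p₀)
    (hTlin : ∀ t ∈ U, IsLinearMap ℂ (T t))
    (hold : ∀ s : ℝ, 0 < s → s < 2 → ∀ t ∈ U, ∀ (g : X → ℂ) (u v : X → ℝ),
      (∀ y, 0 ≤ u y) → (∀ y, 0 ≤ v y) →
      (∀ y, ‖g y‖ ≤ u y ^ (s / 2) * v y ^ (1 - s / 2)) → ∀ x,
      (‖T t g x‖₊ : ℝ≥0∞) ≤ (‖L t (fun y => (u y : ℂ)) x‖₊ : ℝ≥0∞) ^ (s / 2) *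
        (‖L t (fun y => (v y : ℂ)) x‖₊ : ℝ≥0∞) ^ (1 - s / 2))
    (hL : ∀ t ∈ U, ∀ f x, (‖L t f x‖₊ : ℝ≥0∞) ≤ ‖T t f x‖₊ + 2 * (‖H t f x‖₊ : ℝ≥0∞))
    (hH : ∀ p : ℝ, 1 < p → p ≤ 2 → ∃ C : ℝ≥0∞, C ≠ ⊤ ∧ ∀ f : X → ℂ,
      ∑' x, (⨆ t : U, (‖H t f x‖₊ : ℝ≥0∞)) ^ p ≤ C * ∑' x, (‖f x‖₊ : ℝ≥0∞) ^ p)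
    (hT : ∀ p : ℝ, p₀ < p → p ≤ 2 → ∃ C : ℝ≥0∞, C ≠ ⊤ ∧ ∀ n, ∀ f : X → ℂ,
      ∑' x, (⨆ t : D0 n, (‖T t f x‖₊ : ℝ≥0∞)) ^ p ≤ C * ∑' x, (‖f x‖₊ : ℝ≥0∞) ^ p)
    (S : ℤ → (X → ℂ) → X → ℂ) (hSlin : ∀ n, IsLinearMap ℂ (S n))
    (hSLP : ∀ p : ℝ, 1 < p → ∃ C : ℝ≥0∞, C ≠ ⊤ ∧ ∀ f : X → ℂ,
      ∑' x, ((∑' n, (‖S n f x‖₊ : ℝ≥0∞) ^ 2) ^ (1 / 2 : ℝ)) ^ p ≤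
        C * ∑' x, (‖f x‖₊ : ℝ≥0∞) ^ p)
    (β : ℤ → ℝ≥0∞) (hβ0 : ∀ j, β j ≠ 0) (hβt : ∀ j, β j ≠ ⊤)
    (hTS : ∀ j, ∀ f : X → ℂ,
      ∑' x, ((∑' n, ⨆ t : D0 n, (‖T t (S (j + n) f) x‖₊ : ℝ≥0∞) ^ 2) ^ (1 / 2 : ℝ)) ^ (2 : ℝ) ≤
        β j ^ (2 : ℝ) * ∑' x, (‖f x‖₊ : ℝ≥0∞) ^ (2 : ℝ))
    (hβsum : ∀ ρ : ℝ, 0 < ρ → ∑' j, β j ^ ρ ≠ ⊤)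
    (hdec : ∀ n, ∀ t ∈ D0 n, ∀ f : X → ℂ, ∑' x, (‖f x‖₊ : ℝ≥0∞) ^ (2 : ℝ) ≠ ⊤ → ∀ x,
      (‖T t f x‖₊ : ℝ≥0∞) ≤ ∑' j, (‖T t (S (j + n) f) x‖₊ : ℝ≥0∞))
    (p : ℝ) (hp1 : p₀ < p) (hp2 : p ≤ 2) :
    ∃ C : ℝ≥0∞, C ≠ ⊤ ∧ ∀ f : X → ℂ,
      ∑' x, ((∑' n, ⨆ t : D0 n, (‖T t f x‖₊ : ℝ≥0∞) ^ 2) ^ (1 / 2 : ℝ)) ^ p ≤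
        C * ∑' x, (‖f x‖₊ : ℝ≥0∞) ^ p := by
  have hp0 : 0 < p := by linarith
  obtain ⟨C0, hC0, σ, hσ, hQ⟩ := ao_Qj U T L H D0 hD0 p₀ hp₀ hTlin hold hL hH hT S hSlin hSLP β
    hβ0 hβt hTS p hp1 hp2
  set W : ℝ≥0∞ := (∑' j, β j ^ (σ / p)) ^ (p / 2) * (∑' j, β j ^ (σ / 2)) with hW
  have hWt : W ≠ ⊤ := ENNReal.mul_ne_top
    (ENNReal.rpow_ne_top_of_nonneg (by positivity) (hβsum _ (by positivity)))
    (hβsum _ (by positivity))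
  set C1 : ℝ≥0∞ := W * C0 + 1 with hC1
  have hC1t : C1 ≠ ⊤ := ENNReal.add_ne_top.mpr ⟨ENNReal.mul_ne_top hWt hC0, by simp⟩
  have hC11 : 1 ≤ C1 := le_add_self
  have hC10 : C1 ≠ 0 := (lt_of_lt_of_le one_pos hC11).ne'
  have hη : 0 ≤ 1 - p / 2 := by linarith
  have hstep : ∀ (D : ℤ → Set ℝ), (∀ n, D n ⊆ D0 n) → ∀ B : ℝ≥0∞, 1 ≤ B → B ≠ ⊤ →
      (∀ f : X → ℂ, ∑' x, (⨆ n, ⨆ t : D n, (‖T t f x‖₊ : ℝ≥0∞)) ^ p ≤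
        B * ∑' x, (‖f x‖₊ : ℝ≥0∞) ^ p) →
      ∀ f : X → ℂ, ∑' x, ((∑' n, ⨆ t : D n, (‖T t f x‖₊ : ℝ≥0∞) ^ 2) ^ (1 / 2 : ℝ)) ^ p ≤
        C1 * B ^ (1 - p / 2) * ∑' x, (‖f x‖₊ : ℝ≥0∞) ^ p := by
    intro D hD B hB1 hBt hval f
    have hB0 : B ≠ 0 := (lt_of_lt_of_le one_pos hB1).ne'
    have hBq0 : B ^ (1 - p / 2) ≠ 0 := (ENNReal.rpow_pos (pos_iff_ne_zero.mpr hB0) hBt).ne'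
    rcases eq_or_ne (∑' x, (‖f x‖₊ : ℝ≥0∞) ^ p) ⊤ with h | h
    · rw [h, ENNReal.mul_top (mul_ne_zero hC10 hBq0)]; exact le_top
    have := ao_sumj T S D p hp0 hp2 β hβ0 hβt σ hσ
      (C0 * B ^ (1 - p / 2) * ∑' x, (‖f x‖₊ : ℝ≥0∞) ^ p) f
      (fun n t ht x => hdec n t (hD n ht) f (ao_l2 hp0 hp2 f h) x)
      (fun j => (hQ D hD B hB1 hBt hval j f h).trans (le_of_eq (by ring)))
    refine this.trans ?_
    rw [← hW]
    calc W * (C0 * B ^ (1 - p / 2) * ∑' x, (‖f x‖₊ : ℝ≥0∞) ^ p)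
        = (W * C0) * B ^ (1 - p / 2) * ∑' x, (‖f x‖₊ : ℝ≥0∞) ^ p := by ring
      _ ≤ _ := by
        refine mul_le_mul' (mul_le_mul' ?_ le_rfl) le_rfl
        rw [hC1]; exact le_self_add
  have hsup : ∀ (D : ℤ → Set ℝ) (f : X → ℂ) x, (⨆ n, ⨆ t : D n, (‖T t f x‖₊ : ℝ≥0∞)) ≤
      (∑' n, ⨆ t : D n, (‖T t f x‖₊ : ℝ≥0∞) ^ 2) ^ (1 / 2 : ℝ) := by
    intro D f x
    refine iSup_le fun n => iSup_le fun t => ?_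
    rw [one_div, ENNReal.le_rpow_inv_iff (by norm_num), ENNReal.rpow_two]
    exact (le_iSup (fun t : D n => (‖T t f x‖₊ : ℝ≥0∞) ^ 2) t).trans
      (ENNReal.le_tsum (f := fun n => ⨆ t : D n, (‖T t f x‖₊ : ℝ≥0∞) ^ 2) n)
  set DN : ℕ → ℤ → Set ℝ := fun N n => {t | t ∈ D0 n ∧ n.natAbs ≤ N} with hDN
  have hDN0 : ∀ N n, DN N n ⊆ D0 n := fun N n t ht => ht.1
  obtain ⟨CT, hCT, hTp⟩ := hT p hp1 hp2
  set Bs : ℝ≥0∞ := (2 * C1) ^ (1 / (1 - (1 - p / 2))) with hBs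
  have hBst : Bs ≠ ⊤ := ENNReal.rpow_ne_top_of_nonneg
    (one_div_nonneg.mpr (by linarith)) (ENNReal.mul_ne_top (by simp) hC1t)
  have hunif : ∀ N, ∀ f : X → ℂ, ∑' x, (⨆ n, ⨆ t : DN N n, (‖T t f x‖₊ : ℝ≥0∞)) ^ p ≤
        Bs * ∑' x, (‖f x‖₊ : ℝ≥0∞) ^ p := by
    intro N
    have hb := ao_boot (1 - p / 2) (by linarith) C1
      {B | 1 ≤ B ∧ ∀ f : X → ℂ, ∑' x, (⨆ n, ⨆ t : DN N n, (‖T t f x‖₊ : ℝ≥0∞)) ^ p ≤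
        B * ∑' x, (‖f x‖₊ : ℝ≥0∞) ^ p} (fun B hB => hB.1) ?_ ?_
    · obtain ⟨B, hB, hBle⟩ := hb
      exact fun f => (hB.2 f).trans (mul_le_mul' hBle le_rfl)
    · refine ⟨∑ n ∈ Finset.Icc (-(N : ℤ)) N, CT + 1, ⟨le_add_self, fun f => ?_⟩, ?_⟩
      · calc ∑' x, (⨆ n, ⨆ t : DN N n, (‖T t f x‖₊ : ℝ≥0∞)) ^ p
            ≤ ∑' x, ∑ n ∈ Finset.Icc (-(N : ℤ)) N, (⨆ t : D0 n, (‖T t f x‖₊ : ℝ≥0∞)) ^ p := by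
              refine ENNReal.tsum_le_tsum fun x => ?_
              rw [← ENNReal.le_rpow_inv_iff hp0]
              refine iSup_le fun n => iSup_le fun t => ?_
              rw [ENNReal.le_rpow_inv_iff hp0]
              have hn : n ∈ Finset.Icc (-(N : ℤ)) N := by
                have := t.2.2
                rw [Finset.mem_Icc]; omega
              refine le_trans ?_ (Finset.single_le_sum
                (f := fun n => (⨆ t : D0 n, (‖T t f x‖₊ : ℝ≥0∞)) ^ p) (fun _ _ => bot_le) hn)
              exact ENNReal.rpow_le_rpow
                (le_iSup (fun t : D0 n => (‖T t f x‖₊ : ℝ≥0∞)) ⟨t, t.2.1⟩) hp0.le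
          _ = ∑ n ∈ Finset.Icc (-(N : ℤ)) N, ∑' x, (⨆ t : D0 n, (‖T t f x‖₊ : ℝ≥0∞)) ^ p :=
              Summable.tsum_finsetSum fun _ _ => ENNReal.summable
          _ ≤ ∑ n ∈ Finset.Icc (-(N : ℤ)) N, CT * ∑' x, (‖f x‖₊ : ℝ≥0∞) ^ p :=
              Finset.sum_le_sum fun n _ => hTp n f
          _ = (∑ n ∈ Finset.Icc (-(N : ℤ)) N, CT) * ∑' x, (‖f x‖₊ : ℝ≥0∞) ^ p := by
              rw [Finset.sum_mul]
          _ ≤ _ := mul_le_mul' le_self_add le_rfl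
      · exact ENNReal.add_ne_top.mpr ⟨(ENNReal.sum_lt_top.mpr fun _ _ => hCT.lt_top).ne, by simp⟩
    · rintro B ⟨hB1, hval⟩ hBt
      refine ⟨?_, fun f => ?_⟩
      · exact one_le_mul hC11 (by simpa using ENNReal.rpow_le_rpow hB1 hη)
      · refine le_trans ?_ (hstep (DN N) (hDN0 N) B hB1 hBt hval f)
        exact ENNReal.tsum_le_tsum fun x => ENNReal.rpow_le_rpow (hsup _ f x) hp0.le
  have hfull : ∀ f : X → ℂ, ∑' x, (⨆ n, ⨆ t : D0 n, (‖T t f x‖₊ : ℝ≥0∞)) ^ p ≤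
        (Bs + 1) * ∑' x, (‖f x‖₊ : ℝ≥0∞) ^ p := by
    intro f
    have h := ao_mono (fun N x => ⨆ n, ⨆ t : DN N n, (‖T t f x‖₊ : ℝ≥0∞)) ?_ p hp0
      (Bs * ∑' x, (‖f x‖₊ : ℝ≥0∞) ^ p) (fun N => hunif N f)
    · refine le_trans ?_ (h.trans (mul_le_mul' le_self_add le_rfl))
      refine ENNReal.tsum_le_tsum fun x => ENNReal.rpow_le_rpow ?_ hp0.le
      refine iSup_le fun n => iSup_le fun t => ?_
      refine le_trans ?_ (le_iSup (fun N => ⨆ n, ⨆ t : DN N n, (‖T t f x‖₊ : ℝ≥0∞)) n.natAbs)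
      refine le_trans ?_ (le_iSup (fun m => ⨆ t : DN n.natAbs m, (‖T t f x‖₊ : ℝ≥0∞)) n)
      exact le_iSup (fun t : DN n.natAbs n => (‖T t f x‖₊ : ℝ≥0∞)) ⟨t, t.2, le_rfl⟩
    · intro N N' hN x
      refine iSup_mono fun n => iSup_le fun t => ?_
      exact le_iSup (fun t : DN N' n => (‖T t f x‖₊ : ℝ≥0∞)) ⟨t, t.2.1, t.2.2.trans hN⟩
  exact ⟨C1 * (Bs + 1) ^ (1 - p / 2), ENNReal.mul_ne_top hC1t
    (ENNReal.rpow_ne_top_of_nonneg hη (ENNReal.add_ne_top.mpr ⟨hBst, by simp⟩)),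
    hstep D0 (fun _ => le_rfl) (Bs + 1) le_add_self (ENNReal.add_ne_top.mpr ⟨hBst, by simp⟩) hfull⟩

lemma ao_lp_iff (d : ℕ) {p : ℝ} (hp : 0 < p) (g h : (Fin d → ℤ) → ℝ≥0∞) (c : ℝ≥0∞) :
    lpZ d (ENNReal.ofReal p) g ≤ c * lpZ d (ENNReal.ofReal p) h ↔
      ∑' x, g x ^ p ≤ c ^ p * ∑' x, h x ^ p := by
  have e : ∀ g : (Fin d → ℤ) → ℝ≥0∞, lpZ d (ENNReal.ofReal p) g = (∑' x, g x ^ p) ^ (1 / p) := by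
    intro g
    rw [lpZ, if_neg ENNReal.ofReal_ne_top, ENNReal.toReal_ofReal hp.le]
  have hc : c = (c ^ p) ^ (1 / p) := by
    rw [← ENNReal.rpow_mul, mul_one_div_cancel hp.ne', ENNReal.rpow_one]
  rw [e, e]
  nth_rewrite 1 [hc]
  rw [← ENNReal.mul_rpow_of_nonneg _ _ (by positivity), ENNReal.rpow_le_rpow_iff (by positivity)]

lemma ao_lp_two (d : ℕ) (g : (Fin d → ℤ) → ℝ≥0∞) :
    lpZ d 2 g = (∑' x, g x ^ (2 : ℝ)) ^ (1 / 2 : ℝ) := by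
  rw [lpZ, if_neg (by norm_num)]
  simp

lemma ao_hold {X : Type*} (T M H : (X → ℂ) → X → ℂ) (hM : IsLinearMap ℂ M) (hH : IsLinearMap ℂ H)
    (hpM : ∀ f, (∀ x, (f x).im = 0 ∧ 0 ≤ (f x).re) → ∀ x, (M f x).im = 0 ∧ 0 ≤ (M f x).re)
    (hpH : ∀ f, (∀ x, (f x).im = 0 ∧ 0 ≤ (f x).re) → ∀ x, (H f x).im = 0 ∧ 0 ≤ (H f x).re)
    (hT : ∀ f, T f = M f - H f) (s : ℝ) (hs0 : 0 < s) (hs2 : s < 2)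
    (g : X → ℂ) (u v : X → ℝ) (hu : ∀ y, 0 ≤ u y) (hv : ∀ y, 0 ≤ v y)
    (hg : ∀ y, ‖g y‖ ≤ u y ^ (s / 2) * v y ^ (1 - s / 2)) (x : X) :
    (‖T g x‖₊ : ℝ≥0∞) ≤
      (‖M (fun y => (u y : ℂ)) x + H (fun y => (u y : ℂ)) x‖₊ : ℝ≥0∞) ^ (s / 2) *
        (‖M (fun y => (v y : ℂ)) x + H (fun y => (v y : ℂ)) x‖₊ : ℝ≥0∞) ^ (1 - s / 2) := by
  let φM : (X → ℂ) →ₗ[ℂ] ℂ := (LinearMap.proj x).comp (hM.mk' M)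
  let φH : (X → ℂ) →ₗ[ℂ] ℂ := (LinearMap.proj x).comp (hH.mk' H)
  have h1 : ‖M g x‖ ≤ (M (fun y => ((‖g y‖ : ℝ) : ℂ)) x).re :=
    ao_pos_norm φM (fun f hf => hpM f hf x) g (fun y => ‖g y‖) (fun _ => le_rfl)
  have h2 : ‖H g x‖ ≤ (H (fun y => ((‖g y‖ : ℝ) : ℂ)) x).re :=
    ao_pos_norm φH (fun f hf => hpH f hf x) g (fun y => ‖g y‖) (fun _ => le_rfl)
  have h3 := ao_pos_holder (φM + φH) (fun f hf => by
    have hm := hpM f hf x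
    have hh := hpH f hf x
    change (M f x + H f x).im = 0 ∧ 0 ≤ (M f x + H f x).re
    rw [Complex.add_im, Complex.add_re, hm.1, hh.1]
    exact ⟨by simp, add_nonneg hm.2 hh.2⟩) (fun y => ‖g y‖) u v hu hv (1 - s / 2) (by linarith)
    (by linarith) (fun _ => norm_nonneg _) (fun y => by rw [_root_.sub_sub_cancel]; exact hg y)
  rw [_root_.sub_sub_cancel] at h3
  change (M (fun y => ((‖g y‖ : ℝ) : ℂ)) x + H (fun y => ((‖g y‖ : ℝ) : ℂ)) x).re ≤
    ‖M (fun y => (u y : ℂ)) x + H (fun y => (u y : ℂ)) x‖ ^ (s / 2) *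
      ‖M (fun y => (v y : ℂ)) x + H (fun y => (v y : ℂ)) x‖ ^ (1 - s / 2) at h3
  rw [Complex.add_re] at h3
  have h4 : ‖T g x‖ ≤ ‖M g x‖ + ‖H g x‖ := by rw [hT]; exact norm_sub_le _ _
  have h5 := h4.trans ((add_le_add h1 h2).trans h3)
  have e : ∀ z : ℂ, (‖z‖₊ : ℝ≥0∞) = ENNReal.ofReal ‖z‖ := fun z => (ofReal_norm z).symm
  rw [e, e, e, ENNReal.ofReal_rpow_of_nonneg (norm_nonneg _) (by linarith),
    ENNReal.ofReal_rpow_of_nonneg (norm_nonneg _) (by linarith),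
    ← ENNReal.ofReal_mul (by positivity)]
  exact ENNReal.ofReal_le_ofReal h5

lemma ao_cover (a : ℤ → ℝ) (A : ℝ) (hA : 1 < A) (ha_pos : ∀ n, 0 < a n)
    (ha : ∀ n : ℤ, A ≤ a (n + 1) / a n) (t : ℝ) (ht : 0 < t) :
    ∃ n, t ∈ Set.Ico (a n) (a (n + 1)) := by
  have hA0 : 0 < A := by linarith
  have hs : ∀ n, A * a n ≤ a (n + 1) := fun n => (le_div_iff₀ (ha_pos n)).mp (ha n)
  have hmono : StrictMono a := strictMono_int_of_lt_succ fun n =>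
    lt_of_lt_of_le (by nlinarith [ha_pos n]) (hs n)
  have hup : ∀ k : ℕ, A ^ k * a 0 ≤ a k := by
    intro k
    induction k with
    | zero => simp
    | succ k ih =>
      have := hs k
      push_cast
      calc A ^ (k + 1) * a 0 = A * (A ^ k * a 0) := by ring
        _ ≤ A * a k := by gcongr
        _ ≤ _ := this
  have hdn : ∀ k : ℕ, A ^ k * a (-k) ≤ a 0 := by
    intro k
    induction k with
    | zero => simp
    | succ k ih =>
      have := hs (-(k + 1 : ℤ))
      rw [show -(k + 1 : ℤ) + 1 = -k by ring] at this
      push_cast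
      calc A ^ (k + 1) * a (-(k + 1 : ℤ)) = A ^ k * (A * a (-(k + 1 : ℤ))) := by ring
        _ ≤ A ^ k * a (-k) := by gcongr
        _ ≤ _ := ih
  obtain ⟨k1, hk1⟩ := pow_unbounded_of_one_lt (t / a 0) hA
  obtain ⟨k2, hk2⟩ := pow_unbounded_of_one_lt (a 0 / t) hA
  rw [div_lt_iff₀ (ha_pos 0)] at hk1
  rw [div_lt_iff₀ ht] at hk2
  obtain ⟨n, hn, hmax⟩ := Int.exists_greatest_of_bdd (P := fun z => a z ≤ t)
    ⟨k1, fun z hz => by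
      by_contra hcon
      push Not at hcon
      have := hmono hcon
      linarith [hup k1]⟩
    ⟨-k2, by
      have h1 := hdn k2
      have h2 : A ^ k2 * a (-k2) < A ^ k2 * t := by linarith
      exact (lt_of_mul_lt_mul_left h2 (by positivity)).le⟩
  refine ⟨n, hn, ?_⟩
  by_contra hcon
  push Not at hcon
  have := hmax _ hcon
  omega

/-- the almost orthogonality principle (Proposition 4.1). -/
theorem statement9
    (d : ℕ) (U : Set ℝ) (hU : U ⊆ Set.Ioi (0 : ℝ))
    (a : ℤ → ℝ) (A : ℝ) (hA : 1 < A) (ha_pos : ∀ n, 0 < a n)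
    (ha_lac : ∀ n : ℤ, A ≤ a (n + 1) / a n ∧ a (n + 1) / a n ≤ A ^ 2)
    (T M H : ℝ → ((Fin d → ℤ) → ℂ) → ((Fin d → ℤ) → ℂ))
    (hlinM : ∀ t ∈ U, IsLinearMap ℂ (M t)) (hlinH : ∀ t ∈ U, IsLinearMap ℂ (H t))
    (hposM : ∀ t ∈ U, ∀ f, NonnegFun f → NonnegFun (M t f))
    (hposH : ∀ t ∈ U, ∀ f, NonnegFun f → NonnegFun (H t f))
    (hTMH : ∀ t ∈ U, ∀ f, T t f = M t f - H t f)
    -- (i) the maximal operator of `H` is bounded on ℓ^p for all p ∈ (1,2]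
    (hH : ∀ p : ℝ, 1 < p → p ≤ 2 → ∃ C : ℝ, ∀ f : (Fin d → ℤ) → ℂ,
      lpZ d (ENNReal.ofReal p) (fun x => ⨆ t : U, (‖H (↑t) f x‖₊ : ℝ≥0∞))
        ≤ ENNReal.ofReal C * lpZ d (ENNReal.ofReal p) (nnC f))
    -- (ii) uniform bounds for the block maximal operators of `T` for p ∈ (p₀,2]
    (p₀ : ℝ) (hp₀1 : 1 < p₀) (hp₀2 : p₀ < 2)
    (hT : ∀ p : ℝ, p₀ < p → p ≤ 2 → ∃ C : ℝ, ∀ n : ℤ, ∀ f : (Fin d → ℤ) → ℂ,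
      lpZ d (ENNReal.ofReal p)
          (fun x => ⨆ t : ↥(Set.Ico (a n) (a (n + 1)) ∩ U), (‖T (↑t) f x‖₊ : ℝ≥0∞))
        ≤ ENNReal.ofReal C * lpZ d (ENNReal.ofReal p) (nnC f))
    -- (iii) a resolution of the identity `S` ...
    (S : ℤ → ((Fin d → ℤ) → ℂ) → ((Fin d → ℤ) → ℂ))
    (hlinS : ∀ n, IsLinearMap ℂ (S n))
    -- ... summing to the identity in ℓ²
    (hSid : ∀ f : (Fin d → ℤ) → ℂ, lpZ d 2 (nnC f) ≠ ∞ →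
      Filter.Tendsto (fun s : Finset ℤ => lpZ d 2 (nnC fun x => f x - ∑ n ∈ s, S n f x))
        Filter.atTop (nhds 0))
    -- ... satisfying the Littlewood–Paley inequality for all p ∈ (1,∞)
    (hSLP : ∀ p : ℝ, 1 < p → ∃ C : ℝ, 0 < C ∧ ∀ f : (Fin d → ℤ) → ℂ,
      lpZ d (ENNReal.ofReal p)
          (fun x => (∑' n : ℤ, (‖S n f x‖₊ : ℝ≥0∞) ^ 2) ^ (1 / 2 : ℝ))
        ≤ ENNReal.ofReal (C * A) * lpZ d (ENNReal.ofReal p) (nnC f))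
    -- ... and positive numbers `b_j` with all their ρ-th power sums finite, controlling
    -- the ℓ² square functions of `T` against translates of `S`
    (b : ℤ → ℝ) (hb_pos : ∀ j, 0 < b j)
    (hb_sum : ∀ ρ : ℝ, 0 < ρ → Summable fun j => b j ^ ρ)
    (hTS : ∀ j : ℤ, ∀ f : (Fin d → ℤ) → ℂ, lpZ d 2 (nnC f) ≤ 1 →
      lpZ d 2
          (fun x => (∑' n : ℤ, ⨆ t : ↥(Set.Ico (a n) (a (n + 1)) ∩ U),
            (‖T (↑t) (S (j + n) f) x‖₊ : ℝ≥0∞) ^ 2) ^ (1 / 2 : ℝ))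
        ≤ ENNReal.ofReal (b j))
    (p : ℝ) (hp1 : p₀ < p) (hp2 : p ≤ 2) :
    ∃ C : ℝ, 0 < C ∧ ∀ f : (Fin d → ℤ) → ℂ,
      lpZ d (ENNReal.ofReal p)
          (fun x => (∑' n : ℤ, ⨆ t : ↥(Set.Ico (a n) (a (n + 1)) ∩ U),
            (‖T (↑t) f x‖₊ : ℝ≥0∞) ^ 2) ^ (1 / 2 : ℝ))
        ≤ ENNReal.ofReal C * lpZ d (ENNReal.ofReal p) (nnC f) ∧
      lpZ d (ENNReal.ofReal p) (fun x => ⨆ t : U, (‖T (↑t) f x‖₊ : ℝ≥0∞))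
        ≤ ENNReal.ofReal C * lpZ d (ENNReal.ofReal p) (nnC f) := by
  have hp0 : 0 < p := by linarith
  set D0 : ℤ → Set ℝ := fun n => Set.Ico (a n) (a (n + 1)) ∩ U with hD0
  have hD0U : ∀ n, D0 n ⊆ U := fun n t ht => ht.2
  have hTlin : ∀ t ∈ U, IsLinearMap ℂ (T t) := by
    intro t ht
    refine ⟨fun f g => ?_, fun c f => ?_⟩
    · rw [hTMH t ht, hTMH t ht, hTMH t ht, (hlinM t ht).map_add, (hlinH t ht).map_add]; abel
    · rw [hTMH t ht, hTMH t ht, (hlinM t ht).map_smul, (hlinH t ht).map_smul, smul_sub]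
  have hbR : ∀ j, ENNReal.ofReal (b j) ≠ 0 := fun j => by
    simpa using hb_pos j
  have hcont : ∀ n, ∃ K : ℝ≥0∞, K ≠ ⊤ ∧ ∀ t ∈ D0 n, ∀ (g : (Fin d → ℤ) → ℂ) x,
      (‖T t g x‖₊ : ℝ≥0∞) ≤ K * lpZ d 2 (nnC g) := by
    intro n
    obtain ⟨C, hC⟩ := hT 2 hp₀2 le_rfl
    refine ⟨ENNReal.ofReal C, ENNReal.ofReal_ne_top, fun t ht g x => ?_⟩
    have h := hC n g
    rw [ENNReal.ofReal_ofNat] at h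
    refine le_trans ?_ h
    rw [ao_lp_two, one_div, ENNReal.le_rpow_inv_iff (by norm_num)]
    refine le_trans (ENNReal.rpow_le_rpow ?_ (by norm_num)) (ENNReal.le_tsum x)
    exact le_iSup (fun t : D0 n => (‖T t g x‖₊ : ℝ≥0∞)) ⟨t, ht⟩
  have hmain := ao_main U T (fun t f => M t f + H t f) H D0 hD0U p₀ hp₀1 hTlin
    (fun s hs0 hs2 t ht g u v hu hv hg x => ao_hold (T t) (M t) (H t) (hlinM t ht) (hlinH t ht)
      (hposM t ht) (hposH t ht) (hTMH t ht) s hs0 hs2 g u v hu hv hg x) ?_ ?_ ?_ S hlinS ?_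
    (fun j => ENNReal.ofReal (b j)) hbR (fun j => ENNReal.ofReal_ne_top) ?_ ?_ ?_ p hp1 hp2
  · obtain ⟨C, hCt, hC⟩ := hmain
    have hfin : C ^ (1 / p) ≠ ⊤ := ENNReal.rpow_ne_top_of_nonneg (by positivity) hCt
    have hle : C ^ (1 / p) ≤ ENNReal.ofReal ((C ^ (1 / p)).toReal + 1) := by
      rw [ENNReal.ofReal_add ENNReal.toReal_nonneg zero_le_one, ENNReal.ofReal_toReal hfin]
      exact le_self_add
    refine ⟨(C ^ (1 / p)).toReal + 1, by positivity, fun f => ?_⟩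
    have h1 : lpZ d (ENNReal.ofReal p)
          (fun x => (∑' n : ℤ, ⨆ t : D0 n, (‖T (↑t) f x‖₊ : ℝ≥0∞) ^ 2) ^ (1 / 2 : ℝ))
        ≤ ENNReal.ofReal ((C ^ (1 / p)).toReal + 1) * lpZ d (ENNReal.ofReal p) (nnC f) := by
      refine le_trans ?_ (mul_le_mul' hle le_rfl)
      rw [ao_lp_iff d hp0, ← ENNReal.rpow_mul, one_div_mul_cancel hp0.ne', ENNReal.rpow_one]
      exact hC f
    refine ⟨h1, le_trans ?_ h1⟩
    rw [← one_mul (lpZ d (ENNReal.ofReal p) (fun x => (∑' n : ℤ, ⨆ t : D0 n,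
      (‖T (↑t) f x‖₊ : ℝ≥0∞) ^ 2) ^ (1 / 2 : ℝ))), ao_lp_iff d hp0, ENNReal.one_rpow, one_mul]
    refine ENNReal.tsum_le_tsum fun x => ENNReal.rpow_le_rpow ?_ hp0.le
    refine iSup_le fun t => ?_
    obtain ⟨n, hn⟩ := ao_cover a A hA ha_pos (fun n => (ha_lac n).1) t (hU t.2)
    rw [one_div, ENNReal.le_rpow_inv_iff (by norm_num), ENNReal.rpow_two]
    exact (le_iSup (fun t : D0 n => (‖T t f x‖₊ : ℝ≥0∞) ^ 2) ⟨t, hn, t.2⟩).trans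
      (ENNReal.le_tsum (f := fun n => ⨆ t : D0 n, (‖T t f x‖₊ : ℝ≥0∞) ^ 2) n)
  · intro t ht f x
    have e : (M t f + H t f) x = T t f x + 2 * H t f x := by
      rw [hTMH t ht]; simp only [Pi.add_apply, Pi.sub_apply]; ring
    change (‖(M t f + H t f) x‖₊ : ℝ≥0∞) ≤ _
    rw [e]
    have : ‖T t f x + 2 * H t f x‖₊ ≤ ‖T t f x‖₊ + 2 * ‖H t f x‖₊ := by
      refine (nnnorm_add_le _ _).trans ?_
      rw [nnnorm_mul]; simp
    exact_mod_cast this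
  · intro p h1 h2
    obtain ⟨C, hC⟩ := hH p h1 h2
    exact ⟨ENNReal.ofReal C ^ p, ENNReal.rpow_ne_top_of_nonneg (by linarith) ENNReal.ofReal_ne_top,
      fun f => (ao_lp_iff d (by linarith) _ _ _).mp (hC f)⟩
  · intro p h1 h2
    obtain ⟨C, hC⟩ := hT p h1 h2
    exact ⟨ENNReal.ofReal C ^ p, ENNReal.rpow_ne_top_of_nonneg (by linarith) ENNReal.ofReal_ne_top,
      fun n f => (ao_lp_iff d (by linarith) _ _ _).mp (hC n f)⟩
  · intro p h1
    obtain ⟨C, _, hC⟩ := hSLP p h1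
    exact ⟨ENNReal.ofReal (C * A) ^ p,
      ENNReal.rpow_ne_top_of_nonneg (by linarith) ENNReal.ofReal_ne_top,
      fun f => (ao_lp_iff d (by linarith) _ _ _).mp (hC f)⟩
  · intro j f
    have hhom : ∀ (c : ℂ) x, ((∑' n, ⨆ t : D0 n, (‖T t (S (j + n) (c • f)) x‖₊ : ℝ≥0∞) ^ 2)
        ^ (1 / 2 : ℝ)) ^ (2 : ℝ) = (‖c‖₊ : ℝ≥0∞) ^ 2 *
        ((∑' n, ⨆ t : D0 n, (‖T t (S (j + n) f) x‖₊ : ℝ≥0∞) ^ 2) ^ (1 / 2 : ℝ)) ^ (2 : ℝ) := by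
      intro c x
      have e : ∀ z : ℝ≥0∞, (z ^ (1 / 2 : ℝ)) ^ (2 : ℝ) = z := fun z => by
        rw [← ENNReal.rpow_mul]; simp
      rw [e, e, ← ENNReal.tsum_mul_left]
      refine tsum_congr fun n => ?_
      rw [ENNReal.mul_iSup]
      refine iSup_congr fun t => ?_
      rw [(hlinS _).map_smul, (hTlin t t.2.2).map_smul, Pi.smul_apply, smul_eq_mul, nnnorm_mul,
        ENNReal.coe_mul, mul_pow]
    set N := ∑' x, (‖f x‖₊ : ℝ≥0∞) ^ (2 : ℝ) with hN
    have hscale : ∀ r : ℝ, 0 < r → ENNReal.ofReal r ^ 2 * N ≤ 1 → ENNReal.ofReal r ^ 2 *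
        ∑' x, ((∑' n, ⨆ t : D0 n, (‖T t (S (j + n) f) x‖₊ : ℝ≥0∞) ^ 2) ^ (1 / 2 : ℝ)) ^ (2 : ℝ) ≤
        ENNReal.ofReal (b j) ^ (2 : ℝ) := by
      intro r hr hrN
      have hr' : (‖(r : ℂ)‖₊ : ℝ≥0∞) = ENNReal.ofReal r := by
        rw [← enorm_eq_nnnorm, ← ofReal_norm, Complex.norm_real, Real.norm_of_nonneg hr.le]
      have h := hTS j ((r : ℂ) • f) ?_
      · rw [ao_lp_two, one_div, ENNReal.rpow_inv_le_iff (by norm_num)] at h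
        rw [← one_div] at h
        simp_rw [← hr']
        rw [← ENNReal.tsum_mul_left]
        refine le_trans (le_of_eq (tsum_congr fun x => (hhom r x).symm)) h
      · rw [ao_lp_two, one_div, ENNReal.rpow_inv_le_iff (by norm_num), ENNReal.one_rpow]
        refine le_trans (le_of_eq ?_) hrN
        rw [hN, ← ENNReal.tsum_mul_left]
        refine tsum_congr fun x => ?_
        simp only [nnC, Pi.smul_apply, smul_eq_mul, nnnorm_mul, ENNReal.coe_mul, hr']
        rw [ENNReal.mul_rpow_of_nonneg _ _ (by norm_num), ENNReal.rpow_two]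
    set Q := ∑' x, ((∑' n, ⨆ t : D0 n, (‖T t (S (j + n) f) x‖₊ : ℝ≥0∞) ^ 2) ^ (1 / 2 : ℝ)) ^ (2 : ℝ)
    have hb2t : ENNReal.ofReal (b j) ^ (2 : ℝ) ≠ ⊤ :=
      ENNReal.rpow_ne_top_of_nonneg (by norm_num) ENNReal.ofReal_ne_top
    have hb20 : ENNReal.ofReal (b j) ^ (2 : ℝ) ≠ 0 :=
      (ENNReal.rpow_pos (pos_iff_ne_zero.mpr (hbR j)) ENNReal.ofReal_ne_top).ne'
    change Q ≤ ENNReal.ofReal (b j) ^ (2 : ℝ) * N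
    rcases eq_or_ne N ⊤ with hNt | hNt
    · rw [hNt, ENNReal.mul_top hb20]; exact le_top
    rcases eq_or_ne N 0 with hN0 | hN0
    · have hf0 : f = 0 := by
        rw [hN, ENNReal.tsum_eq_zero] at hN0
        funext x
        have := hN0 x
        simpa using this
      have : Q = 0 := by
        rw [ENNReal.tsum_eq_zero]
        intro x
        have := hhom 0 x
        rw [zero_smul] at this
        rw [hf0, this]; simp
      rw [this]; exact bot_le
    · have hNr : 0 < N.toReal := ENNReal.toReal_pos hN0 hNt
      have hr : ENNReal.ofReal (Real.sqrt (N.toReal)⁻¹) ^ 2 = N⁻¹ := by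
        rw [← ENNReal.ofReal_pow (Real.sqrt_nonneg _), Real.sq_sqrt (by positivity),
          ENNReal.ofReal_inv_of_pos hNr, ENNReal.ofReal_toReal hNt]
      have h := hscale (Real.sqrt (N.toReal)⁻¹) (Real.sqrt_pos.mpr (by positivity))
        (by rw [hr, ENNReal.inv_mul_cancel hN0 hNt])
      rw [hr, mul_comm, ← div_eq_mul_inv] at h
      exact (ENNReal.div_le_iff hN0 hNt).mp h
  · intro ρ hρ
    simp_rw [ENNReal.ofReal_rpow_of_pos (hb_pos _)]
    exact (hb_sum ρ hρ).tsum_ofReal_ne_top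
  · intro n t ht f hf x
    have htU := hD0U n ht
    obtain ⟨K, hKt, hK⟩ := hcont n
    have hlim := hSid f (by
      rw [ao_lp_two]; exact ENNReal.rpow_ne_top_of_nonneg (by norm_num) hf)
    have hre : ∑' j, (‖T t (S (j + n) f) x‖₊ : ℝ≥0∞) = ∑' j, (‖T t (S j f) x‖₊ : ℝ≥0∞) :=
      (Equiv.addRight n).tsum_eq (fun j => (‖T t (S j f) x‖₊ : ℝ≥0∞))
    rw [hre]
    have hlim2 := (ENNReal.Tendsto.const_mul hlim (Or.inr hKt) (a := K)).add_const
      (∑' j, (‖T t (S j f) x‖₊ : ℝ≥0∞))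
    rw [mul_zero, zero_add] at hlim2
    refine ge_of_tendsto hlim2 (Filter.Eventually.of_forall fun s => ?_)
    let Tl := (hTlin t htU).mk' (T t)
    have e : (fun x => f x - ∑ n ∈ s, S n f x) = f - ∑ n ∈ s, S n f := by
      funext y; simp
    have e2 : T t (f - ∑ n ∈ s, S n f) = T t f - ∑ n ∈ s, T t (S n f) := by
      change Tl _ = Tl _ - ∑ n ∈ s, Tl _
      rw [map_sub, map_sum]
    have h1 := hK t ht (fun x => f x - ∑ n ∈ s, S n f x) x
    rw [e, e2] at h1
    rw [e]
    have h2 : T t f x = (T t f - ∑ n ∈ s, T t (S n f)) x + ∑ n ∈ s, T t (S n f) x := by simp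
    calc (‖T t f x‖₊ : ℝ≥0∞)
        ≤ ‖(T t f - ∑ n ∈ s, T t (S n f)) x‖₊ + ∑ n ∈ s, (‖T t (S n f) x‖₊ : ℝ≥0∞) := by
          have : ‖T t f x‖₊ ≤ ‖(T t f - ∑ n ∈ s, T t (S n f)) x‖₊ +
              ∑ n ∈ s, ‖T t (S n f) x‖₊ := by
            rw [h2]
            refine (nnnorm_add_le _ _).trans (add_le_add ?_ (nnnorm_sum_le _ _))
            simp
          exact_mod_cast this
      _ ≤ _ := add_le_add h1 (ENNReal.sum_le_tsum s)
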